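/- arXiv:math/0501309 — 4 statements merged into one kernel-verified Lean document; each statement's English description precedes it below -/
import Mathlib

section
/- Let p ≥ 5 be prime, n ≥ 1, s ∈ ℤ_p^n, and let τ = (H_1,…,H_n) with H_i ∈ ℤ_p[x_1,…,x_n] satisfy: (i) H_i(s) ≡ s_i (mod p) for all i, and (ii) the Jacobian matrix of τ at s is congruent to the identity I_n modulo p. Then there exist power series f_1,…,f_n ∈ ℚ_p[[z]] that converge on all of ℤ_p and satisfy f_i(0) = s_i and f_i(z+1) = H_i(f_1(z),…,f_n(z)) for all z ∈ ℤ_p and all i. -/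
open MvPolynomial in
/-- `ArcFiltration s k f` says that `f` has weight at least `k`, where `p` has weight `2` and
each `X i - s i` has weight `1`. -/
inductive ArcFiltration {p : ℕ} [Fact p.Prime] {n : ℕ} (s : Fin n → ℤ_[p]) :
    ℕ → MvPolynomial (Fin n) ℤ_[p] → Prop
  | const (c : ℤ_[p]) : ArcFiltration s 0 (C c)
  | prime : ArcFiltration s 2 (C (p : ℤ_[p]))
  | coord (i : Fin n) : ArcFiltration s 1 (X i - C (s i))
  | add {k : ℕ} {f g : MvPolynomial (Fin n) ℤ_[p]} :
      ArcFiltration s k f → ArcFiltration s k g → ArcFiltration s k (f + g)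
  | mul {j k : ℕ} {f g : MvPolynomial (Fin n) ℤ_[p]} :
      ArcFiltration s j f → ArcFiltration s k g → ArcFiltration s (j + k) (f * g)
  | mono {j k : ℕ} {f : MvPolynomial (Fin n) ℤ_[p]} :
      j ≤ k → ArcFiltration s k f → ArcFiltration s j f

namespace ArcFiltration

open MvPolynomial

variable {p : ℕ} [Fact p.Prime] {n : ℕ} {s : Fin n → ℤ_[p]}

lemma weight_zero (f : MvPolynomial (Fin n) ℤ_[p]) : ArcFiltration s 0 f := by
  induction f using MvPolynomial.induction_on with
  | C a => exact const a
  | add f g hf hg => exact hf.add hg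
  | mul_X f i hf =>
    have h : ArcFiltration s 0 (X i) := by
      simpa using ((coord (s := s) i).mono (Nat.zero_le 1)).add (const (s := s) (s i))
    exact hf.mul h

lemma const_mul {k : ℕ} {f : MvPolynomial (Fin n) ℤ_[p]} (g : MvPolynomial (Fin n) ℤ_[p])
    (hf : ArcFiltration s k f) : ArcFiltration s k (g * f) := by
  simpa using (weight_zero g).mul hf

lemma zero (k : ℕ) : ArcFiltration s k 0 := by
  have h : ∀ k : ℕ, ArcFiltration s (k * 2) (C (p : ℤ_[p]) ^ k) := by
    intro k
    induction k with
    | zero => exact weight_zero _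
    | succ k ih => rw [pow_succ, Nat.succ_mul]; exact ih.mul prime
  simpa using (const_mul 0 (h k)).mono (j := k) (by omega)

lemma sum {ι : Type*} {k : ℕ} (t : Finset ι) (f : ι → MvPolynomial (Fin n) ℤ_[p])
    (h : ∀ i ∈ t, ArcFiltration s k (f i)) : ArcFiltration s k (∑ i ∈ t, f i) :=
  Finset.sum_induction f (ArcFiltration s k) (fun _ _ => add) (zero k) h

lemma of_toZMod_eq_zero {c : ℤ_[p]} (hc : PadicInt.toZMod c = 0) :
    ArcFiltration s 2 (C c) := by
  have h : c ∈ RingHom.ker (PadicInt.toZMod (p := p)) := hc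
  rw [PadicInt.ker_toZMod, PadicInt.maximalIdeal_eq_span_p, Ideal.mem_span_singleton] at h
  obtain ⟨d, rfl⟩ := h
  rw [mul_comm, C_mul]
  exact const_mul _ prime

/-- First-order Taylor expansion at `s`. -/
lemma taylor (f : MvPolynomial (Fin n) ℤ_[p]) :
    ArcFiltration s 2
      (f - C (eval s f) - ∑ j, C (eval s (pderiv j f)) * (X j - C (s j))) := by
  induction f using MvPolynomial.induction_on with
  | C a => simpa using zero 2
  | add f g hf hg =>
    convert hf.add hg using 1
    simp only [map_add, add_mul, Finset.sum_add_distrib]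
    ring
  | mul_X f i hf =>
    have hlin : ArcFiltration s 1 (∑ j, C (eval s (pderiv j f)) * (X j - C (s j))) :=
      sum _ _ fun j _ => const_mul _ (coord j)
    convert (const_mul (X i) hf).add (hlin.mul (coord i)) using 1
    have hsum : ∑ j, C (eval s (pderiv j (f * X i))) * (X j - C (s j)) =
        C (s i) * ∑ j, C (eval s (pderiv j f)) * (X j - C (s j)) +
          C (eval s f) * (X i - C (s i)) := by
      have hterm : ∀ j, C (eval s (pderiv j (f * X i))) * (X j - C (s j)) =
          C (s i) * (C (eval s (pderiv j f)) * (X j - C (s j))) +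
            if j = i then C (eval s f) * (X i - C (s i)) else 0 := by
        intro j
        by_cases hj : j = i
        · subst hj
          simp [Derivation.leibniz]
          ring
        · simp [Derivation.leibniz, pderiv_X_of_ne (Ne.symm hj), hj]
          ring
      simp only [hterm, Finset.sum_add_distrib, ← Finset.mul_sum, Finset.sum_ite_eq',
        Finset.mem_univ, if_true]
    rw [hsum]
    simp only [map_mul, eval_X]
    ring

lemma sub_X {H : Fin n → MvPolynomial (Fin n) ℤ_[p]}
    (h1 : ∀ i, PadicInt.toZMod (eval s (H i)) = PadicInt.toZMod (s i))
    (h2 : (Matrix.of fun i j => PadicInt.toZMod (eval s (pderiv j (H i)))) =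
      (1 : Matrix (Fin n) (Fin n) (ZMod p))) (i : Fin n) :
    ArcFiltration s 2 (H i - X i) := by
  have hJ : ArcFiltration s 2
      (∑ j, C (eval s (pderiv j (H i)) - if i = j then 1 else 0) * (X j - C (s j))) := by
    refine sum _ _ fun j _ => ?_
    rw [mul_comm]
    refine const_mul _ (of_toZMod_eq_zero ?_)
    have := congrFun (congrFun h2 i) j
    rw [Matrix.of_apply, Matrix.one_apply] at this
    rw [map_sub, this]
    split_ifs <;> simp
  have h0 : ArcFiltration s 2 (C (eval s (H i) - s i)) :=
    of_toZMod_eq_zero (by rw [map_sub, h1, sub_self])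
  convert ((taylor (H i)).add hJ).add h0 using 1
  simp only [map_sub, sub_mul, Finset.sum_sub_distrib, apply_ite C, ite_mul, map_one, map_zero,
    one_mul, zero_mul, Finset.sum_ite_eq, Finset.mem_univ, if_true]
  ring

/-- A substitution that moves each variable by weight `2` raises the weight when the identity is
subtracted from it. -/
lemma bind₁_sub {H : Fin n → MvPolynomial (Fin n) ℤ_[p]}
    (hH : ∀ i, ArcFiltration s 2 (H i - X i)) {k : ℕ} {f : MvPolynomial (Fin n) ℤ_[p]}
    (hf : ArcFiltration s k f) : ArcFiltration s (k + 1) (bind₁ H f - f) := by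
  induction hf with
  | const c => simpa using zero 1
  | prime => rw [algHom_C, algebraMap_eq, sub_self]; exact zero _
  | coord i => simpa using hH i
  | add _ _ hf hg =>
    rw [map_add, add_sub_add_comm]
    exact hf.add hg
  | @mul j k f g hf0 hg0 hf hg =>
    have hσ : ArcFiltration s k (bind₁ H g) := by
      simpa using (hg.mono (Nat.le_succ k)).add hg0
    have h1 := (hf.mul hσ).mono (j := j + k + 1) (by omega)
    have h2 := (hf0.mul hg).mono (j := j + k + 1) (by omega)
    convert h1.add h2 using 1
    rw [map_mul]
    ring
  | mono hjk _ hf => exact hf.mono (by omega)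

lemma norm_eval_le {q : ℝ} (hq0 : 0 ≤ q) (hq1 : q ≤ 1) (hq : q ^ 4 = (p : ℝ)⁻¹)
    {k : ℕ} {f : MvPolynomial (Fin n) ℤ_[p]} (hf : ArcFiltration s k f) :
    ‖eval s f‖ ≤ q ^ (2 * k) := by
  induction hf with
  | const c => simpa using PadicInt.norm_le_one c
  | prime => simp [hq]
  | coord i => simpa using pow_nonneg hq0 2
  | add _ _ hf hg =>
    rw [map_add]
    exact (PadicInt.nonarchimedean _ _).trans (max_le hf hg)
  | mul _ _ hf hg =>
    rw [map_mul, norm_mul, mul_add, pow_add]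
    gcongr
  | mono hjk _ hf => exact hf.trans (pow_le_pow_of_le_one hq0 hq1 (by omega))

end ArcFiltration

open MvPolynomial in
/-- The difference operator `f ↦ f ∘ H - f`. -/
noncomputable def diffOp {R : Type*} [CommRing R] {n : ℕ} (H : Fin n → MvPolynomial (Fin n) R) :
    Module.End R (MvPolynomial (Fin n) R) :=
  (bind₁ H).toLinearMap - 1

lemma sum_choose_diffOp_pow {R : Type*} [CommRing R] {n : ℕ}
    (H : Fin n → MvPolynomial (Fin n) R) (f : MvPolynomial (Fin n) R) (N : ℕ) :
    ∑ m ∈ Finset.range (N + 1), (N.choose m : R) • (diffOp H ^ m) f =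
      (MvPolynomial.bind₁ H)^[N] f := by
  have h : (MvPolynomial.bind₁ H).toLinearMap = diffOp H + 1 := by simp [diffOp]
  have hpow : ((MvPolynomial.bind₁ H)^[N] f) =
      (((MvPolynomial.bind₁ H).toLinearMap) ^ N) f := by
    rw [Module.End.pow_apply]
    rfl
  rw [hpow, h, (Commute.one_right _).add_pow, LinearMap.sum_apply]
  refine Finset.sum_congr rfl fun m _ => ?_
  rw [one_pow, mul_one, ← Nat.cast_comm, ← nsmul_eq_mul, LinearMap.smul_apply,
    Nat.cast_smul_eq_nsmul]

lemma eval_iterate_bind₁ {R : Type*} [CommRing R] {n : ℕ}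
    (H : Fin n → MvPolynomial (Fin n) R) (s : Fin n → R) (f : MvPolynomial (Fin n) R) (N : ℕ) :
    MvPolynomial.eval s ((MvPolynomial.bind₁ H)^[N] f) =
      MvPolynomial.eval
        (fun j => MvPolynomial.eval s ((MvPolynomial.bind₁ H)^[N] (MvPolynomial.X j))) f := by
  induction f using MvPolynomial.induction_on with
  | C a =>
    have : (MvPolynomial.bind₁ H)^[N] (MvPolynomial.C a) = MvPolynomial.C a :=
      Function.iterate_fixed (by simp) N
    simp [this]
  | add f g hf hg => rw [iterate_map_add, map_add, hf, hg, map_add]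
  | mul_X f i hf => rw [iterate_map_mul, map_mul, hf, map_mul, MvPolynomial.eval_X]

lemma norm_inv_factorial_le {p : ℕ} [Fact p.Prime] (hp : 5 ≤ p) {q : ℝ} (hq0 : 0 < q)
    (hq1 : q ≤ 1) (hq : q ^ 4 = (p : ℝ)⁻¹) (m : ℕ) :
    ‖((m.factorial : ℚ_[p]))⁻¹‖ ≤ (q ^ m)⁻¹ := by
  have hv : 4 * padicValNat p m.factorial ≤ m := by
    have h := sub_one_mul_padicValNat_factorial (p := p) m
    have h4 : 4 * padicValNat p m.factorial ≤ (p - 1) * padicValNat p m.factorial :=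
      Nat.mul_le_mul_right _ (by omega)
    omega
  have hnorm : ‖(m.factorial : ℚ_[p])‖ = q ^ (4 * padicValNat p m.factorial) := by
    rw [Padic.norm_eq_zpow_neg_valuation (by exact_mod_cast m.factorial_ne_zero),
      Padic.valuation_natCast, pow_mul, hq, zpow_neg, zpow_natCast, inv_pow]
  rw [norm_inv, hnorm]
  exact inv_anti₀ (pow_pos hq0 _) (pow_le_pow_of_le_one hq0.le hq1 hv)

/-- A series of falling factorials with geometrically small coefficients is a convergent
power series on `ℤ_[p]`, and continuous there. -/
lemma exists_powerSeries_of_descPochhammer {p : ℕ} [Fact p.Prime] {q : ℝ} (hq0 : 0 ≤ q)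
    (hq1 : q < 1) (g : ℕ → ℚ_[p]) (hg : ∀ m, ‖g m‖ ≤ q ^ m) :
    ∃ a : ℕ → ℚ_[p], Filter.Tendsto (fun k => ‖a k‖) Filter.atTop (nhds 0) ∧
      Continuous (fun z : ℤ_[p] => ∑' k, a k * (z : ℚ_[p]) ^ k) ∧
      ∀ z : ℤ_[p], ∑' k, a k * (z : ℚ_[p]) ^ k =
        ∑' m, g m * (((descPochhammer ℤ_[p] m).eval z : ℤ_[p]) : ℚ_[p]) := by
  set c : ℕ → ℕ → ℚ_[p] := fun m k => (((descPochhammer ℤ_[p] m).coeff k : ℤ_[p]) : ℚ_[p])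
  have hc : ∀ m k, ‖c m k‖ ≤ 1 := fun m k => PadicInt.norm_le_one _
  have hc0 : ∀ m k, k ∉ Finset.range (m + 1) → c m k = 0 := by
    intro m k hk
    have hdeg : (descPochhammer ℤ_[p] m).natDegree < k := by
      rw [descPochhammer_natDegree]
      simpa using hk
    simp [c, Polynomial.coeff_eq_zero_of_natDegree_lt hdeg]
  have hsumm : ∀ z : ℤ_[p],
      Summable (fun x : ℕ × ℕ => g x.1 * c x.1 x.2 * (z : ℚ_[p]) ^ x.2) := by
    intro z
    have hz : ∀ k : ℕ, ‖(z : ℚ_[p]) ^ k‖ ≤ 1 := fun k => by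
      rw [norm_pow]; exact pow_le_one₀ (norm_nonneg _) z.2
    have hbound : ∀ m k, ‖g m * c m k * (z : ℚ_[p]) ^ k‖ ≤ q ^ m := fun m k => by
      rw [norm_mul, norm_mul]
      calc ‖g m‖ * ‖c m k‖ * ‖(z : ℚ_[p]) ^ k‖ ≤ q ^ m * 1 * 1 := by
            gcongr
            exacts [hg m, hc m k, hz k]
        _ = q ^ m := by ring
    have hfin : ∀ m k, k ∉ Finset.range (m + 1) → ‖g m * c m k * (z : ℚ_[p]) ^ k‖ = 0 :=
      fun m k hk => by rw [hc0 m k hk]; simp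
    refine Summable.of_norm ((summable_prod_of_nonneg fun _ => norm_nonneg _).2 ⟨fun m => ?_, ?_⟩)
    · exact summable_of_ne_finset_zero (s := Finset.range (m + 1)) (hfin m)
    · have hmaj : Summable (fun m : ℕ => (m : ℝ) * q ^ m + q ^ m) := by
        refine Summable.add ?_ (summable_geometric_of_lt_one hq0 hq1)
        simpa using summable_pow_mul_geometric_of_norm_lt_one 1
          (r := q) (by rwa [Real.norm_of_nonneg hq0])
      refine Summable.of_nonneg_of_le (fun m => tsum_nonneg fun _ => norm_nonneg _)
        (fun m => ?_) hmaj
      dsimp only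
      rw [tsum_eq_sum (s := Finset.range (m + 1)) (hfin m)]
      refine (Finset.sum_le_card_nsmul _ _ _ fun k _ => hbound m k).trans (le_of_eq ?_)
      rw [Finset.card_range, nsmul_eq_mul]
      push_cast
      ring
  have heval : ∀ (z : ℤ_[p]) (m : ℕ), ∑' k, g m * c m k * (z : ℚ_[p]) ^ k =
      g m * (((descPochhammer ℤ_[p] m).eval z : ℤ_[p]) : ℚ_[p]) := by
    intro z m
    rw [tsum_eq_sum (s := Finset.range (m + 1)) fun k hk => by rw [hc0 m k hk]; simp,
      Polynomial.eval_eq_sum_range, descPochhammer_natDegree, PadicInt.coe_sum, Finset.mul_sum]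
    simp [c, mul_assoc]
  have hswap : ∀ z : ℤ_[p], ∑' k, (∑' m, g m * c m k) * (z : ℚ_[p]) ^ k =
      ∑' m, g m * (((descPochhammer ℤ_[p] m).eval z : ℤ_[p]) : ℚ_[p]) := by
    intro z
    simp_rw [← heval z, ← tsum_mul_right]
    exact Summable.tsum_comm (f := fun m k => g m * c m k * (z : ℚ_[p]) ^ k) (hsumm z)
  refine ⟨fun k => ∑' m, g m * c m k, ?_, ?_, hswap⟩
  · have hone : Summable (fun x : ℕ × ℕ => g x.1 * c x.1 x.2) := by
      simpa using hsumm 1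
    have hswapped : Summable (fun x : ℕ × ℕ => g x.2 * c x.2 x.1) := hone.prod_symm
    have hcol : Summable (fun k => ∑' m, g m * c m k) := hswapped.prod
    exact tendsto_zero_iff_norm_tendsto_zero.1 hcol.tendsto_atTop_zero
  · simp_rw [hswap]
    refine continuous_tsum (u := fun m => q ^ m) (fun m => ?_)
      (summable_geometric_of_lt_one hq0 hq1) fun m z => ?_
    · have hcoe : Continuous ((↑) : ℤ_[p] → ℚ_[p]) := continuous_subtype_val
      have hpoly := (descPochhammer ℤ_[p] m).continuous
      exact (hcoe.comp hpoly).const_mul (g m)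
    · rw [norm_mul]
      calc _ ≤ q ^ m * 1 := by
            gcongr
            exacts [hg m, PadicInt.norm_le_one _]
        _ = q ^ m := mul_one _


/-- The `p`-adic analytic arc theorem: for `p ≥ 5` and a polynomial map `τ = (H_1,…,H_n)`
fixing `s` mod `p` with Jacobian at `s` congruent to the identity mod `p`, there are power
series `f_1,…,f_n` convergent on `ℤ_p` with `f_i(0) = s_i` and `f_i(z+1) = H_i(f(z))`. -/
theorem stmt6 (p : ℕ) [Fact p.Prime] (hp : 5 ≤ p) (n : ℕ) (hn : 1 ≤ n)
    (s : Fin n → ℤ_[p]) (H : Fin n → MvPolynomial (Fin n) ℤ_[p])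
    (h1 : ∀ i, PadicInt.toZMod (MvPolynomial.eval s (H i)) = PadicInt.toZMod (s i))
    (h2 : (Matrix.of fun i j =>
        PadicInt.toZMod (MvPolynomial.eval s (MvPolynomial.pderiv j (H i)))) =
      (1 : Matrix (Fin n) (Fin n) (ZMod p))) :
    ∃ a : Fin n → ℕ → ℚ_[p],
      (∀ i, Filter.Tendsto (fun k => ‖a i k‖) Filter.atTop (nhds 0)) ∧
      (∀ i, (∑' k : ℕ, a i k * ((0 : ℤ_[p]) : ℚ_[p]) ^ k) = (s i : ℚ_[p])) ∧
      (∀ (i : Fin n) (z : ℤ_[p]),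
        (∑' k : ℕ, a i k * (((z + 1 : ℤ_[p])) : ℚ_[p]) ^ k) =
          MvPolynomial.aeval (fun j => ∑' k : ℕ, a j k * ((z : ℚ_[p])) ^ k) (H i)) := by
  obtain ⟨q, hq0, hq1, hq⟩ : ∃ q : ℝ, 0 < q ∧ q < 1 ∧ q ^ 4 = (p : ℝ)⁻¹ := by
    have hp0 : (0 : ℝ) < (p : ℝ)⁻¹ := by positivity
    have hp1 : (p : ℝ)⁻¹ < 1 := inv_lt_one_of_one_lt₀ (by exact_mod_cast (by omega : 1 < p))
    refine ⟨(p : ℝ)⁻¹ ^ ((4 : ℕ) : ℝ)⁻¹, Real.rpow_pos_of_pos hp0 _,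
      Real.rpow_lt_one hp0.le hp1 (by norm_num), Real.rpow_inv_natCast_pow hp0.le (by norm_num)⟩
  set b : Fin n → ℕ → ℤ_[p] := fun i m =>
    MvPolynomial.eval s ((diffOp H ^ m) (MvPolynomial.X i))
  have hfilt : ∀ i m, ArcFiltration s m ((diffOp H ^ m) (MvPolynomial.X i)) := by
    intro i m
    induction m with
    | zero => exact ArcFiltration.weight_zero _
    | succ m ih =>
      rw [pow_succ', Module.End.mul_apply]
      exact ArcFiltration.bind₁_sub (ArcFiltration.sub_X h1 h2) ih
  have hg : ∀ i m, ‖(b i m : ℚ_[p]) * (m.factorial : ℚ_[p])⁻¹‖ ≤ q ^ m := by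
    intro i m
    rw [norm_mul]
    calc _ ≤ q ^ (2 * m) * (q ^ m)⁻¹ := by
          gcongr
          · exact (hfilt i m).norm_eval_le hq0.le hq1.le hq
          · exact norm_inv_factorial_le hp hq0 hq1.le hq m
      _ = q ^ m := by
          have := hq0.ne'
          rw [two_mul, pow_add]
          field_simp
  choose a ha0 hac hae using fun i =>
    exists_powerSeries_of_descPochhammer hq0.le hq1 _ (hg i)
  have hnat : ∀ i (N : ℕ), ∑' k, a i k * (((N : ℤ_[p])) : ℚ_[p]) ^ k =
      (MvPolynomial.eval s ((MvPolynomial.bind₁ H)^[N] (MvPolynomial.X i)) : ℤ_[p]) := by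
    intro i N
    rw [hae, ← sum_choose_diffOp_pow, map_sum, PadicInt.coe_sum]
    have hterm : ∀ m, (b i m : ℚ_[p]) * (m.factorial : ℚ_[p])⁻¹ *
        (((descPochhammer ℤ_[p] m).eval (N : ℤ_[p]) : ℤ_[p]) : ℚ_[p]) =
        (N.choose m : ℚ_[p]) * b i m := by
      intro m
      have hm : (m.factorial : ℚ_[p]) ≠ 0 := by exact_mod_cast m.factorial_ne_zero
      rw [descPochhammer_eval_eq_descFactorial, Nat.descFactorial_eq_factorial_mul_choose]
      push_cast
      field_simp
    simp_rw [hterm]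
    rw [tsum_eq_sum (s := Finset.range (N + 1)) fun m hm => by
      rw [Nat.choose_eq_zero_of_lt (by simpa using hm)]; simp]
    refine Finset.sum_congr rfl fun m _ => ?_
    rw [MvPolynomial.smul_eval]
    push_cast
    rfl
  refine ⟨a, ha0, fun i => ?_, fun i z => ?_⟩
  · simpa using hnat i 0
  · have hcont : Continuous fun z : ℤ_[p] =>
        MvPolynomial.aeval (fun j => ∑' k : ℕ, a j k * ((z : ℚ_[p])) ^ k) (H i) := by
      simp only [MvPolynomial.aeval_def, MvPolynomial.eval₂_eq]
      have := hac
      fun_prop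
    have hshift : Continuous fun z : ℤ_[p] => ∑' k, a i k * ((z + 1 : ℤ_[p]) : ℚ_[p]) ^ k :=
      (hac i).comp (continuous_add_const 1)
    refine congrFun (PadicInt.denseRange_natCast.equalizer hshift hcont (funext fun N => ?_)) z
    have hj : (fun j => ∑' k : ℕ, a j k * (((N : ℤ_[p])) : ℚ_[p]) ^ k) =
        fun j => algebraMap ℤ_[p] ℚ_[p]
          (MvPolynomial.eval s ((MvPolynomial.bind₁ H)^[N] (MvPolynomial.X j))) :=
      funext fun j => hnat j N
    have hN := hnat i (N + 1)
    rw [Function.iterate_succ_apply, MvPolynomial.bind₁_X_right, eval_iterate_bind₁] at hN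
    simp only [Function.comp_apply]
    rw [hj, ← Nat.cast_succ]
    refine hN.trans (Eq.trans ?_ (MvPolynomial.aeval_algebraMap_apply ℚ_[p] _ (H i)).symm)
    rw [MvPolynomial.aeval_eq_eval]
    rfl
end

section
/- Let K be a field of characteristic 0, σ an invertible linear map of K^n, v ∈ K^n, and W ⊆ K^n a linear subspace. Then the set { m ∈ ℕ : σ^m(v) ∈ W } is the union of finitely many arithmetic progressions and a finite set. -/
open Polynomial in
/-- If a polynomial has at least `k` roots and its coefficients in degrees `≥ k` are divisible by
`q`, then all its values are divisible by `q`. -/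
theorem Polynomial.dvd_eval_of_dvd_coeff_of_isRoot {R : Type*} [CommRing R] [IsDomain R] (P : R[X])
    (Z : Finset R) (hZ : ∀ z ∈ Z, P.IsRoot z) (q : R) (hq : ∀ j, Z.card ≤ j → q ∣ P.coeff j)
    (t : R) : q ∣ P.eval t := by
  rcases eq_or_ne P 0 with rfl | hP
  · simp
  obtain ⟨Q, hQ⟩ : (∏ z ∈ Z, (X - C z)) ∣ P :=
    (Multiset.prod_X_sub_C_dvd_iff_le_roots hP Z.val).2
      ((Multiset.le_iff_subset Z.nodup).2 fun z hz => (mem_roots hP).2 (hZ z hz))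
  let π := Ideal.Quotient.mk (Ideal.span {q})
  have hmap : P.map π = (∏ z ∈ Z, (X - C (π z))) * Q.map π := by
    rw [hQ, Polynomial.map_mul, Polynomial.map_prod]
    simp
  have hmonic : (∏ z ∈ Z, (X - C (π z))).Monic := monic_prod_X_sub_C π Z
  have hP0 : P.map π = 0 := by
    by_contra hne
    have : Nontrivial (R ⧸ Ideal.span {q}) := by
      by_contra htriv
      rw [not_nontrivial_iff_subsingleton] at htriv
      exact hne (Subsingleton.elim _ _)
    have hQ0 : Q.map π ≠ 0 := fun h => hne (by rw [hmap, h, mul_zero])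
    have hdeg := congrArg natDegree hmap
    rw [hmonic.natDegree_mul' hQ0, natDegree_prod_of_monic _ _ fun z _ => monic_X_sub_C _] at hdeg
    simp only [natDegree_X_sub_C, Finset.sum_const, smul_eq_mul, mul_one] at hdeg
    apply hne
    rw [← leadingCoeff_eq_zero, leadingCoeff, coeff_map]
    exact Ideal.Quotient.eq_zero_iff_dvd _ _ |>.2 (hq _ (by omega))
  rw [← Ideal.Quotient.eq_zero_iff_dvd]
  change π (P.eval t) = 0
  rw [← eval_map_apply, hP0, eval_zero]

/-- Here `n.descFactorial (n - i) = n! / i!`. -/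
theorem Nat.pow_dvd_pow_mul_descFactorial {p : ℕ} [hp : Fact p.Prime] (hp2 : p ≠ 2) {e i n : ℕ}
    (he : 2 * e ≤ i) (hin : i ≤ n) :
    p ^ (padicValNat p n.factorial + e) ∣ p ^ i * n.descFactorial (n - i) := by
  have h3 : 3 ≤ p := by
    have := hp.out.two_le
    omega
  have hpos := Nat.descFactorial_pos.2 (Nat.sub_le n i)
  have hfac : i.factorial * n.descFactorial (n - i) = n.factorial := by
    have := Nat.factorial_mul_descFactorial (Nat.sub_le n i)
    rwa [Nat.sub_sub_self hin] at this
  have hval : padicValNat p n.factorial =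
      padicValNat p i.factorial + padicValNat p (n.descFactorial (n - i)) := by
    rw [← hfac, padicValNat.mul i.factorial_ne_zero hpos.ne']
  have hleg := sub_one_mul_padicValNat_factorial (p := p) i
  have h2 : 2 * padicValNat p i.factorial ≤ i := by
    calc 2 * padicValNat p i.factorial ≤ (p - 1) * padicValNat p i.factorial :=
          Nat.mul_le_mul_right _ (by omega)
      _ ≤ i := by omega
  have hp0 : p ^ i ≠ 0 := pow_ne_zero _ hp.out.ne_zero
  rw [padicValNat_dvd_iff_le (mul_ne_zero hp0 hpos.ne'), padicValNat.mul hp0 hpos.ne',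
    padicValNat.prime_pow]
  omega

/-- A Newton series `∑ p ^ j * a j * (k choose j)` over a `p`-adically separated domain, for an odd
prime `p`, vanishes identically as soon as it has infinitely many zeros. -/
theorem sum_choose_mul_pow_eq_zero_of_infinite {R : Type*} [CommRing R] [IsDomain R] [CharZero R]
    {p : ℕ} [hp : Fact p.Prime] (hp2 : p ≠ 2) (hsep : ∀ x : R, (∀ k, (p : R) ^ k ∣ x) → x = 0)
    (a : ℕ → R)
    (hinf : {k : ℕ | ∑ j ∈ Finset.range (k + 1), (k.choose j : R) * (p ^ j * a j) = 0}.Infinite)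
    (t : ℕ) : ∑ j ∈ Finset.range (t + 1), (t.choose j : R) * (p ^ j * a j) = 0 := by
  classical
  apply hsep
  intro e
  obtain ⟨Z, hZ, hcard⟩ := hinf.exists_subset_card_eq (2 * e)
  set n := t + Z.sup id with hn
  let P : Polynomial R := ∑ i ∈ Finset.range (n + 1),
    Polynomial.C (((p ^ i * n.descFactorial (n - i) : ℕ) : R) * a i) * descPochhammer R i
  have heval : ∀ m ≤ n, P.eval (m : R) =
      n.factorial * ∑ j ∈ Finset.range (m + 1), (m.choose j : R) * (p ^ j * a j) := by
    intro m hm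
    rw [Finset.sum_subset (Finset.range_mono (Nat.succ_le_succ hm) : _ ⊆ Finset.range (n + 1)),
      Finset.mul_sum, Polynomial.eval_finsetSum]
    · refine Finset.sum_congr rfl fun i hi => ?_
      have hin : i ≤ n := Nat.lt_succ_iff.1 (Finset.mem_range.1 hi)
      have hfac := Nat.factorial_mul_descFactorial (Nat.sub_le n i)
      rw [Nat.sub_sub_self hin] at hfac
      rw [Polynomial.eval_mul, Polynomial.eval_C, descPochhammer_eval_eq_descFactorial,
        Nat.descFactorial_eq_factorial_mul_choose m, ← hfac]
      push_cast
      ring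
    · intro i _ hi
      rw [Nat.choose_eq_zero_of_lt (by simpa using hi)]
      simp
  have hroot : ∀ z ∈ Z.image (Nat.cast : ℕ → R), P.IsRoot z := by
    intro z hz
    obtain ⟨m, hm, rfl⟩ := Finset.mem_image.1 hz
    have hmn : m ≤ n := (Finset.le_sup (f := id) hm).trans (Nat.le_add_left _ _)
    rw [Polynomial.IsRoot, heval m hmn, hZ hm, mul_zero]
  have hcoeff : ∀ j, (Z.image (Nat.cast : ℕ → R)).card ≤ j →
      ((p ^ (padicValNat p n.factorial + e) : ℕ) : R) ∣ P.coeff j := by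
    intro j hj
    rw [Finset.card_image_of_injective _ Nat.cast_injective, hcard] at hj
    rw [Polynomial.finsetSum_coeff]
    refine Finset.dvd_sum fun i hi => ?_
    rw [Polynomial.coeff_C_mul]
    rcases lt_or_ge i j with hij | hij
    · rw [Polynomial.coeff_eq_zero_of_natDegree_lt (by rwa [descPochhammer_natDegree]), mul_zero]
      exact dvd_zero _
    · exact ((Nat.cast_dvd_cast (Nat.pow_dvd_pow_mul_descFactorial hp2 (hj.trans hij)
        (Nat.lt_succ_iff.1 (Finset.mem_range.1 hi)))).mul_right _).mul_right _
  have hdvd := P.dvd_eval_of_dvd_coeff_of_isRoot _ hroot _ hcoeff t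
  rw [heval t (Nat.le_add_right _ _)] at hdvd
  obtain ⟨u, hu⟩ : p ^ padicValNat p n.factorial ∣ n.factorial := pow_padicValNat_dvd
  have hpu : ¬ p ∣ u := by
    rintro ⟨w, rfl⟩
    refine pow_succ_padicValNat_not_dvd (p := p) n.factorial_ne_zero ⟨w, ?_⟩
    rw [pow_succ, mul_assoc]
    exact hu
  have hu' : (n.factorial : R) = (p : R) ^ padicValNat p n.factorial * u := by exact_mod_cast hu
  rw [hu', Nat.cast_pow, pow_add, mul_assoc] at hdvd
  have hdvd := (mul_dvd_mul_iff_left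
    (pow_ne_zero _ (Nat.cast_ne_zero.2 hp.out.ne_zero))).1 hdvd
  have hcop : IsCoprime ((p : R) ^ e) (u : R) := by
    have := (Nat.isCoprime_iff_coprime.2
      (((Nat.Prime.coprime_iff_not_dvd hp.out).2 hpu).pow_left e)).map (Int.castRingHom R)
    simpa using this
  exact hcop.dvd_of_dvd_mul_left hdvd

theorem RingHom.IsIntegralElem.of_comp_left {A B C : Type*} [CommRing A] [CommRing B] [CommRing C]
    {f : A →+* B} {g : B →+* C} {z : C} (h : (g.comp f).IsIntegralElem z) : g.IsIntegralElem z := by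
  obtain ⟨q, hq, hz⟩ := h
  exact ⟨q.map f, hq.map f, by rwa [Polynomial.eval₂_map]⟩

theorem RingHom.IsIntegralElem.of_comp_injective {A B C : Type*} [CommRing A] [CommRing B]
    [CommRing C] {f : A →+* B} {g : B →+* C} (hg : Function.Injective g) {z : B}
    (h : (g.comp f).IsIntegralElem (g z)) : f.IsIntegralElem z := by
  obtain ⟨q, hq, hz⟩ := h
  refine ⟨q, hq, hg ?_⟩
  rwa [Polynomial.hom_eval₂, map_zero]

open MvPolynomial in
/-- Finitely many elements of a field of characteristic zero are integral over `ℤ[x, D⁻¹]`, for a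
finite algebraically independent family `x` and a nonzero `D ∈ ℤ[x]`. -/
theorem exists_algebraicIndependent_isIntegralElem.{u} {K : Type u} [Field K] [CharZero K]
    (S : Finset K) :
    ∃ (ι : Type u) (_ : Finite ι) (x : ι → K) (D : MvPolynomial ι ℤ),
      AlgebraicIndependent ℤ x ∧ D ≠ 0 ∧
      ∀ s ∈ S, (aeval (R := ℤ) x).toRingHom.IsIntegralElem (aeval x D * s) := by
  classical
  let A := Algebra.adjoin ℤ (S : Set K)
  let S' : Set A := Subtype.val ⁻¹' (S : Set K)
  have hS' : Algebra.adjoin ℤ S' = ⊤ := Algebra.adjoin_adjoin_coe_preimage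
  have : Algebra.IsAlgebraic (Algebra.adjoin ℤ S') A := by
    refine ⟨fun a => ?_⟩
    have ha : a ∈ Algebra.adjoin ℤ S' := hS' ▸ Algebra.mem_top
    exact isAlgebraic_algebraMap (⟨a, ha⟩ : Algebra.adjoin ℤ S')
  obtain ⟨t, htS, ht⟩ := exists_isTranscendenceBasis_subset (R := ℤ) S'
  have hfin : S'.Finite := S.finite_toSet.preimage Subtype.val_injective.injOn
  have := ht.isAlgebraic
  obtain ⟨y, hy0, hy⟩ := Algebra.IsAlgebraic.exists_integral_multiples
    (Algebra.adjoin ℤ (Set.range ((↑) : t → A))) hfin.toFinset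
  let e := ht.1.aevalEquiv
  have hcomp : ((aeval (R := ℤ) fun i : t => ((i : A) : K)).toRingHom) =
      (A.val.toRingHom.comp (algebraMap (Algebra.adjoin ℤ (Set.range ((↑) : t → A))) A)).comp
        e.toRingEquiv.toRingHom := by
    apply MvPolynomial.ringHom_ext
    · intro r
      simp [e]
    · intro i
      simp [e]
  refine ⟨t, hfin.subset htS, fun i => ((i : A) : K), e.symm y,
    ht.1.map' (f := A.val) Subtype.val_injective, by simpa using hy0, fun s hs => ?_⟩
  have hsA : s ∈ A := Algebra.subset_adjoin hs
  obtain ⟨q, hq, hz⟩ := hy ⟨s, hsA⟩ (by simpa [S'] using hs)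
  refine ⟨q.map e.symm.toRingEquiv.toRingHom, hq.map _, ?_⟩
  have h1 : aeval (fun i : t => ((i : A) : K)) (e.symm y) = ((y : A) : K) := by
    have := congrArg (fun f => f (e.symm y)) hcomp
    simpa using this
  have h2 := congrArg A.val.toRingHom hz
  rw [Polynomial.hom_eval₂, map_zero] at h2
  have h3 : e.toRingEquiv.toRingHom.comp e.symm.toRingEquiv.toRingHom = RingHom.id _ := by
    ext1 z
    simp
  rw [h1, Polynomial.eval₂_map, hcomp, RingHom.comp_assoc, h3, RingHom.comp_id]
  exact h2

/-- A ring killed by a nonzero integer and generated by finitely many integral elements is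
finite. -/
theorem finite_adjoin_of_isIntegral {R : Type*} [CommRing R] {p : ℕ} (hp : p ≠ 0)
    (hpR : (p : R) = 0) {s : Set R} (hs : s.Finite) (hintegral : ∀ x ∈ s, IsIntegral ℤ x) :
    Finite (Algebra.adjoin ℤ s) := by
  have : Module.Finite ℤ (Algebra.adjoin ℤ s) := .of_fg (fg_adjoin_of_finite hs hintegral)
  refine Module.finite_of_fg_torsion _ fun {x} => ?_
  refine ⟨⟨p, mem_nonZeroDivisors_of_ne_zero (by exact_mod_cast hp)⟩, ?_⟩
  ext
  simp [hpR, Submonoid.smul_def]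

open MvPolynomial in
theorem AlgebraicIndependent.sub_intCast_div {K ι : Type*} [Field K] [CharZero K] {x : ι → K}
    (hx : AlgebraicIndependent ℤ x) {p : ℕ} (hp : p ≠ 0) (c : ι → ℤ) :
    AlgebraicIndependent ℤ fun i => (x i - c i) / p := by
  have hpK : (p : K) ≠ 0 := Nat.cast_ne_zero.2 hp
  have key : ∀ g : MvPolynomial ι ℤ, ∃ (N : ℕ) (h : MvPolynomial ι ℤ),
      C ((p : ℤ) ^ N) * g = aeval (fun i => C (c i) + C (p : ℤ) * X i) h := by
    intro g
    induction g using MvPolynomial.induction_on with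
    | C a => exact ⟨0, C a, by simp⟩
    | add g₁ g₂ h₁ h₂ =>
      obtain ⟨N₁, h₁, e₁⟩ := h₁
      obtain ⟨N₂, h₂, e₂⟩ := h₂
      refine ⟨N₁ + N₂, C ((p : ℤ) ^ N₂) * h₁ + C ((p : ℤ) ^ N₁) * h₂, ?_⟩
      rw [map_add, map_mul, map_mul, ← e₁, ← e₂]
      simp only [map_pow, map_natCast]
      ring
    | mul_X g i h =>
      obtain ⟨N, h, e⟩ := h
      refine ⟨N + 1, h * (X i - C (c i)), ?_⟩
      rw [map_mul, ← e]
      simp only [map_pow, map_natCast, map_sub, aeval_X, aeval_C, algebraMap_eq]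
      ring
  rw [algebraicIndependent_iff]
  intro g hg
  obtain ⟨N, h, e⟩ := key g
  have hcomp : (aeval fun i => (x i - c i) / p).comp
      (aeval fun i => C (c i) + C (p : ℤ) * X i) = aeval (R := ℤ) x := by
    ext i
    simp
    field_simp
    ring
  have h0 : aeval x h = 0 := by
    rw [← hcomp, AlgHom.comp_apply, ← e, map_mul, hg, mul_zero]
  rw [algebraicIndependent_iff.1 hx h h0, map_zero] at e
  exact (mul_eq_zero.1 e).resolve_left (by simpa using fun h => absurd h hp)

open MvPolynomial in
/-- Specialisation: there are a valuation subring and elements `y = (x - c) / p` in it such that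
`p` is a nonunit and `D` is a unit. -/
theorem exists_valuationSubring_inv_notMem {K ι : Type*} [Field K] [CharZero K] {x : ι → K}
    (hx : AlgebraicIndependent ℤ x) {p : ℕ} (hp : p.Prime) (D : MvPolynomial ι ℤ) (c : ι → ℤ)
    (hD : IsCoprime (eval c D) (p : ℤ)) :
    ∃ V : ValuationSubring K, (p : K)⁻¹ ∉ V ∧ (∀ i, (x i - c i) / p ∈ V) ∧
      (aeval x D)⁻¹ ∈ V := by
  have hpK : (p : K) ≠ 0 := Nat.cast_ne_zero.2 hp.ne_zero
  have : Fact p.Prime := ⟨hp⟩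
  have hy := hx.sub_intCast_div hp.ne_zero c
  set y := fun i => (x i - c i) / (p : K) with hydef
  let φ : MvPolynomial ι ℤ →+* K := (aeval y).toRingHom
  have hφ : Function.Injective φ := hy
  let e : MvPolynomial ι ℤ ≃+* φ.range := RingEquiv.ofBijective φ.rangeRestrict
    ⟨fun a b h => hφ (congrArg Subtype.val h), φ.rangeRestrict_surjective⟩
  let ψ : MvPolynomial ι ℤ →+* ZMod p := eval₂Hom (Int.castRingHom (ZMod p)) 0
  obtain ⟨V, hV, hIV⟩ := Ideal.image_subset_nonunits_valuationSubring
    (RingHom.ker (ψ.comp e.symm.toRingHom)) (RingHom.ker_ne_top _)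
  have hVφ : ∀ g, φ g ∈ V := fun g => hV ⟨g, rfl⟩
  have hnon : ∀ g, ψ g = 0 → V.valuation (φ g) < 1 := fun g hg =>
    V.mem_nonunits_iff.1 (hIV ⟨e g, by simpa [RingHom.mem_ker] using hg, rfl⟩)
  have hval_le : ∀ k : ℤ, V.valuation (k : K) ≤ 1 := fun k =>
    (V.valuation_le_one_iff _).2 (intCast_mem V k)
  refine ⟨V, ?_, fun i => by simpa [φ, hydef] using hVφ (X i), ?_⟩
  · have hp1 : V.valuation (p : K) < 1 := by simpa using hnon p (by simp)
    exact (V.mem_nonunits_iff_or.1 (V.mem_nonunits_iff.2 hp1)).resolve_left hpK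
  · obtain ⟨u, w, huw⟩ := hD
    let D' := aeval (fun i => C (c i) + C (p : ℤ) * X i) D
    have hφD : φ D' = aeval x D := by
      have hcomp : (aeval y).comp
          (aeval fun i => C (c i) + C (p : ℤ) * X i) = aeval (R := ℤ) x := by
        ext i
        simp [hydef]
        field_simp
        ring
      rw [← hcomp]
      rfl
    have hψD : ψ D' = (eval c D : ℤ) := by
      have hcomp : ψ.comp (aeval (R := ℤ) fun i => C (c i) + C (p : ℤ) * X i).toRingHom =
          (Int.castRingHom (ZMod p)).comp (eval c) := by
        apply MvPolynomial.ringHom_ext <;> simp [ψ]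
      exact congrArg (fun f => f D) hcomp
    have hlt := hnon (C u * D' - 1) (by
      have := congrArg (Int.cast : ℤ → ZMod p) huw
      push_cast at this
      rw [map_sub, map_mul, map_one, hψD, ← this]
      simp [ψ])
    have hφC : φ (C u) = (u : K) := by simp [φ]
    rw [map_sub, map_mul, map_one, hφD, hφC] at hlt
    have hunit := V.valuation.map_one_add_of_lt hlt
    rw [add_sub_cancel, map_mul] at hunit
    rw [← V.valuation_le_one_iff, map_inv₀]
    calc (V.valuation (aeval x D))⁻¹
        = V.valuation (u : K) := (eq_inv_of_mul_eq_one_left hunit).symm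
      _ ≤ 1 := hval_le u

open MvPolynomial in
/-- Any finite subset `S` of a field of characteristic zero lies in a Noetherian subring in which
an odd prime `p` is not invertible and `S` generates a finite subring modulo `p`. -/
theorem exists_isNoetherianRing_finite_adjoin {K : Type*} [Field K] [CharZero K] (S : Finset K) :
    ∃ (p : ℕ) (A : Subalgebra ℤ K), p.Prime ∧ p ≠ 2 ∧ (S : Set K) ⊆ A ∧ IsNoetherianRing A ∧
      ¬ IsUnit (p : A) ∧
      Finite (Algebra.adjoin ℤ
        (Ideal.Quotient.mk (Ideal.span {(p : A)}) '' (Subtype.val ⁻¹' (S : Set K)))) := by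
  classical
  obtain ⟨ι, _, x, D, hx, hD0, hS⟩ := exists_algebraicIndependent_isIntegralElem S
  obtain ⟨c, hc⟩ : ∃ c : ι → ℤ, eval c D ≠ 0 := by
    by_contra! h
    exact hD0 (MvPolynomial.funext fun c => by rw [h c, map_zero])
  obtain ⟨p, hple, hp⟩ := Nat.exists_infinite_primes ((eval c D).natAbs + 3)
  have hpK : (p : K) ≠ 0 := Nat.cast_ne_zero.2 hp.ne_zero
  have hcop : IsCoprime (eval c D) (p : ℤ) := by
    rw [Int.isCoprime_iff_nat_coprime, Int.natAbs_natCast, Nat.coprime_comm,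
      Nat.Prime.coprime_iff_not_dvd hp]
    intro h
    have := Nat.le_of_dvd (Int.natAbs_pos.2 hc) h
    omega
  obtain ⟨V, hpV, hyV, hDV⟩ := exists_valuationSubring_inv_notMem hx hp D c hcop
  set y := fun i => (x i - c i) / (p : K) with hydef
  set d := aeval x D with hd
  have hd0 : d ≠ 0 := fun h => hD0 (algebraicIndependent_iff.1 hx D h)
  have hxy : ∀ i, x i = c i + p * y i := fun i => by
    simp only [hydef]
    field_simp
    ring
  have hlift : ∀ (B : Type _) [CommRing B] (g : B →+* K) (z : ι → B), (∀ i, g (z i) = x i) →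
      g.comp (aeval (R := ℤ) z).toRingHom = (aeval (R := ℤ) x).toRingHom := by
    intro B _ g z hz
    apply MvPolynomial.ringHom_ext <;> simp [hz]
  have hSV : ∀ s ∈ S, s ∈ V := by
    intro s hs
    have hxV : ∀ i, x i ∈ V := fun i => by
      rw [hxy]
      exact add_mem (intCast_mem V _) (mul_mem (natCast_mem V _) (hyV i))
    have h := hS s hs
    rw [← hlift V V.subtype (fun i => ⟨x i, hxV i⟩) fun i => rfl] at h
    have h : IsIntegral V (d * s) := h.of_comp_left
    obtain ⟨z, hz⟩ := IsIntegrallyClosed.isIntegral_iff.1 h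
    have : d * s ∈ V := hz ▸ z.2
    have := mul_mem hDV this
    rwa [inv_mul_cancel_left₀ hd0] at this
  let G : Set K := S ∪ Set.range y ∪ {d⁻¹}
  have hGfin : G.Finite := (S.finite_toSet.union (Set.finite_range y)).union (Set.finite_singleton _)
  let A := Algebra.adjoin ℤ G
  have hAV : ∀ a ∈ A, a ∈ V := by
    have : A ≤ subalgebraOfSubring V.toSubring := by
      refine Algebra.adjoin_le ?_
      rintro z ((hz | ⟨i, rfl⟩) | rfl)
      · exact hSV z hz
      · exact hyV i
      · exact hDV
    exact fun a ha => this ha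
  have hSA : (S : Set K) ⊆ A := fun s hs => Algebra.subset_adjoin (Or.inl (Or.inl hs))
  have hyA : ∀ i, y i ∈ A := fun i => Algebra.subset_adjoin (Or.inl (Or.inr ⟨i, rfl⟩))
  have hxA : ∀ i, x i ∈ A := fun i => by
    rw [hxy]
    exact add_mem (intCast_mem A _) (mul_mem (natCast_mem A _) (hyA i))
  refine ⟨p, A, hp, by omega, hSA, ?_, ?_, ?_⟩
  · have : Algebra.FiniteType ℤ A :=
      A.fg_iff_finiteType.1 (Subalgebra.fg_def.2 ⟨G, hGfin, rfl⟩)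
    exact Algebra.FiniteType.isNoetherianRing ℤ A
  · intro hu
    obtain ⟨b, hb⟩ := hu.exists_right_inv
    have hb' : (p : K) * b = 1 := by exact_mod_cast congrArg Subtype.val hb
    rw [← eq_inv_of_mul_eq_one_right hb'] at hpV
    exact hpV (hAV _ b.2)
  let π := Ideal.Quotient.mk (Ideal.span {(p : A)})
  have hπp : π (p : A) = 0 := Ideal.Quotient.eq_zero_iff_mem.2 (Ideal.mem_span_singleton_self _)
  have hπp' : (p : A ⧸ Ideal.span {(p : A)}) = 0 := by rw [← hπp, map_natCast]
  refine finite_adjoin_of_isIntegral hp.ne_zero hπp'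
    ((S.finite_toSet.preimage Subtype.val_injective.injOn).image _) ?_
  rintro _ ⟨s, hs, rfl⟩
  let xA : ι → A := fun i => ⟨x i, hxA i⟩
  have hvalα : A.val.toRingHom.comp (aeval (R := ℤ) xA).toRingHom = (aeval (R := ℤ) x).toRingHom :=
    hlift A A.val.toRingHom xA fun i => rfl
  have hπα : π.comp (aeval (R := ℤ) xA).toRingHom =
      (algebraMap ℤ (A ⧸ Ideal.span {(p : A)})).comp (eval c) := by
    apply MvPolynomial.ringHom_ext
    · simp
    · intro i
      have : xA i = (c i : A) + p * ⟨y i, hyA i⟩ := Subtype.ext (by simpa [xA] using hxy i)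
      simp [this, hπp']
  have hintegral : IsIntegral ℤ (π (aeval xA D * s)) := by
    have h := hS s hs
    have hval : aeval x D * (s : K) = A.val.toRingHom (aeval xA D * s) := by
      rw [map_mul]
      exact congrArg (· * (s : K)) (congrArg (fun f => f D) hvalα).symm
    rw [hval, ← hvalα] at h
    have h := (h.of_comp_injective Subtype.val_injective).map π
    rw [hπα] at h
    exact h.of_comp_left
  obtain ⟨u, w, huw⟩ := hcop
  have hπD : π (aeval xA D) = (eval c D : ℤ) := congrArg (fun f => f D) hπα
  have huw' := congrArg (Int.cast : ℤ → A ⧸ Ideal.span {(p : A)}) huw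
  push_cast at huw'
  rw [hπp', mul_zero, add_zero] at huw'
  have : π s = u • π (aeval xA D * s) := by
    rw [map_mul, hπD, zsmul_eq_mul, ← mul_assoc, huw', one_mul]
  rw [this]
  exact hintegral.smul u

section

open Matrix

theorem Matrix.exists_pow_eq_one_add_smul {R n : Type*} [CommRing R] [Fintype n] [DecidableEq n]
    {p : R} {s : Set R}
    (hfin : Finite (Algebra.adjoin ℤ (Ideal.Quotient.mk (Ideal.span {p}) '' s)))
    (M : Matrix n n R) (hM : IsUnit M) (hMs : ∀ i j, M i j ∈ s) :
    ∃ N, 1 ≤ N ∧ ∃ X : Matrix n n R, M ^ N = 1 + p • X := by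
  let π := Ideal.Quotient.mk (Ideal.span {p})
  let T := Algebra.adjoin ℤ (π '' s)
  have : Finite T := hfin
  let MT : Matrix n n T := fun i j => ⟨π (M i j), Algebra.subset_adjoin ⟨_, hMs i j, rfl⟩⟩
  have hMT : ∀ k, T.val.toRingHom.mapMatrix (MT ^ k) = π.mapMatrix M ^ k := fun k => by
    rw [map_pow]
    rfl
  obtain ⟨a, b, hab, he⟩ : ∃ a b, a < b ∧ MT ^ a = MT ^ b := by
    obtain ⟨a, b, hab, he⟩ := Finite.exists_ne_map_eq_of_infinite fun k : ℕ => MT ^ k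
    rcases hab.lt_or_gt with h | h
    · exact ⟨a, b, h, he⟩
    · exact ⟨b, a, h, he.symm⟩
  have he := congrArg T.val.toRingHom.mapMatrix he
  rw [hMT, hMT, ← Nat.add_sub_of_le hab.le, pow_add] at he
  have h1 : π.mapMatrix M ^ (b - a) = 1 :=
    (((hM.map π.mapMatrix).pow a).mul_eq_left.1 he.symm)
  have hdvd : ∀ i j, p ∣ (M ^ (b - a) - 1) i j := by
    intro i j
    rw [← Ideal.mem_span_singleton, ← Ideal.Quotient.eq_zero_iff_mem]
    change π.mapMatrix (M ^ (b - a) - 1) i j = 0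
    rw [map_sub, map_pow, h1, map_one, sub_self, Matrix.zero_apply]
  choose X hX using hdvd
  refine ⟨b - a, by omega, Matrix.of X, ?_⟩
  rw [← sub_eq_iff_eq_add']
  ext i j
  exact hX i j

theorem Matrix.dotProduct_one_add_smul_pow_mulVec {R n : Type*} [CommRing R] [Fintype n]
    [DecidableEq n] (p : R) (X : Matrix n n R) (r w : n → R) (k : ℕ) :
    r ⬝ᵥ ((1 + p • X) ^ k *ᵥ w) =
      ∑ j ∈ Finset.range (k + 1), (k.choose j : R) * (p ^ j * (r ⬝ᵥ (X ^ j *ᵥ w))) := by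
  rw [add_comm, (Commute.one_right (p • X)).add_pow, Matrix.sum_mulVec, dotProduct_sum]
  refine Finset.sum_congr rfl fun j _ => ?_
  rw [one_pow, mul_one, ← nsmul_eq_mul', smul_pow, Matrix.smul_mulVec, Matrix.smul_mulVec,
    dotProduct_smul, dotProduct_smul, nsmul_eq_mul, smul_eq_mul]

/-- For invertible `M`, there is a modulus `N` such that `P (M ^ m v)` vanishes, in each residue
class, for only finitely many `m` or for all `m`. -/
theorem Matrix.exists_residue_finite_or_forall_eq_zero {K n : Type*} [Field K] [CharZero K]
    [Fintype n] [DecidableEq n] (M P : Matrix n n K) (hM : IsUnit M) (v : n → K) :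
    ∃ N, 1 ≤ N ∧ ∀ a, {k : ℕ | P *ᵥ (M ^ (a + N * k) *ᵥ v) = 0}.Finite ∨
      ∀ k, P *ᵥ (M ^ (a + N * k) *ᵥ v) = 0 := by
  classical
  obtain ⟨M', hMM', hM'M⟩ := isUnit_iff_exists.1 hM
  let E : Matrix n n K → Finset K := fun B => Finset.univ.image fun q : n × n => B q.1 q.2
  have hE : ∀ B i j, B i j ∈ E B := fun B i j => Finset.mem_image.2 ⟨(i, j), Finset.mem_univ _, rfl⟩
  obtain ⟨p, A, hp, hp2, hSA, _, hpu, hfin⟩ :=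
    exists_isNoetherianRing_finite_adjoin (E M ∪ E M' ∪ E P ∪ Finset.univ.image v)
  have : Fact p.Prime := ⟨hp⟩
  let lift (B : Matrix n n K) (hB : ∀ i j, B i j ∈ A) : Matrix n n A := fun i j => ⟨B i j, hB i j⟩
  let MA := lift M fun i j => hSA (by simp [hE])
  let MA' := lift M' fun i j => hSA (by simp [hE])
  let PA := lift P fun i j => hSA (by simp [hE])
  let vA : n → A := fun i => ⟨v i, hSA (by simp)⟩
  let ι : A →+* K := A.val.toRingHom
  have hι : Function.Injective ι := Subtype.val_injective
  have hιm : Function.Injective (ι.mapMatrix : Matrix n n A →+* Matrix n n K) :=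
    fun B C h => Matrix.ext fun i j => hι (congrFun (congrFun h i) j)
  have hunit : IsUnit MA := isUnit_iff_exists.2 ⟨MA',
    hιm (by rw [map_mul, map_one]; exact hMM'), hιm (by rw [map_mul, map_one]; exact hM'M)⟩
  obtain ⟨N, hN, X, hX⟩ := MA.exists_pow_eq_one_add_smul hfin hunit
    fun i j => by simp [MA, lift, hE]
  have hsep : ∀ z : A, (∀ k, (p : A) ^ k ∣ z) → z = 0 := by
    intro z hz
    have hbot := Ideal.iInf_pow_eq_bot_of_isDomain (Ideal.span {(p : A)})
      (by rwa [Ne, Ideal.span_singleton_eq_top])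
    rw [← Ideal.mem_bot, ← hbot, Ideal.mem_iInf]
    intro k
    rw [Ideal.span_singleton_pow, Ideal.mem_span_singleton]
    exact hz k
  have hval : ∀ a k i, (P *ᵥ (M ^ (a + N * k) *ᵥ v)) i =
      ι (PA i ⬝ᵥ ((1 + (p : A) • X) ^ k *ᵥ (MA ^ a *ᵥ vA))) := by
    intro a k i
    have hpow : MA ^ (N * k) *ᵥ (MA ^ a *ᵥ vA) = MA ^ (a + N * k) *ᵥ vA := by
      rw [mulVec_mulVec, ← pow_add, add_comm]
    rw [← hX, ← pow_mul, hpow]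
    change _ = ι ((PA *ᵥ (MA ^ (a + N * k) *ᵥ vA)) i)
    rw [RingHom.map_mulVec]
    congr 2
    ext j
    rw [Function.comp_apply, RingHom.map_mulVec]
    congr 2
    exact (map_pow ι.mapMatrix MA _).symm
  refine ⟨N, hN, fun a => ?_⟩
  by_contra! h
  obtain ⟨hinf, k, hk⟩ := h
  apply hk
  ext i
  rw [hval, dotProduct_one_add_smul_pow_mulVec,
    sum_choose_mul_pow_eq_zero_of_infinite hp2 hsep _ (Set.Infinite.mono _ hinf) k]
  · simp
  · intro m hm
    have := congrFun hm i
    rw [hval, Pi.zero_apply, map_eq_zero_iff ι hι, dotProduct_one_add_smul_pow_mulVec] at this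
    exact this

end

/-- Linear-algebraic Skolem–Mahler–Lech: for an invertible linear map `σ` of `K^n`
(`char K = 0`), a vector `v`, and a subspace `W`, the set `{m : σ^m v ∈ W}` is a union
of finitely many arithmetic progressions and a finite set. -/
theorem stmt8 (K : Type*) [Field K] [CharZero K] (n : ℕ)
    (σ : Module.End K (Fin n → K)) (hσ : Function.Bijective σ)
    (v : Fin n → K) (W : Submodule K (Fin n → K)) :
    ∃ (Fs : Finset ℕ) (P : Finset (ℕ × ℕ)), (∀ q ∈ P, 1 ≤ q.2) ∧
      {m : ℕ | (σ ^ m) v ∈ W} =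
        ↑Fs ∪ ⋃ q ∈ P, {x : ℕ | ∃ d : ℕ, x = q.1 + q.2 * d} := by
  classical
  obtain ⟨W', hW'⟩ := W.exists_isCompl
  let π : Module.End K (Fin n → K) := Submodule.projection W' W hW'.symm
  have hπ : ∀ w, π w = 0 ↔ w ∈ W := fun w => Submodule.projection_apply_eq_zero_iff hW'.symm
  let e := LinearMap.toMatrixAlgEquiv' (R := K) (n := Fin n)
  have hunit : IsUnit (e σ) := ((Module.End.isUnit_iff σ).2 hσ).map e
  have hmem : ∀ m, (σ ^ m) v ∈ W ↔ (e π).mulVec ((e σ ^ m).mulVec v) = 0 := fun m => by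
    have he : ∀ f w, (e f).mulVec w = f w := fun f w => LinearMap.toMatrix'_mulVec f w
    rw [← hπ, ← map_pow, he, he]
  obtain ⟨N, hN, h⟩ := (e σ).exists_residue_finite_or_forall_eq_zero (e π) hunit v
  simp only [← hmem] at h
  have hfin : (⋃ a ∈ (Finset.range N).filter fun a => ¬ ∀ k, (σ ^ (a + N * k)) v ∈ W,
      (fun k => a + N * k) '' {k | (σ ^ (a + N * k)) v ∈ W}).Finite := by
    refine Set.Finite.biUnion (Finset.finite_toSet _) fun a ha => ?_
    exact ((h a).resolve_right (Finset.mem_filter.1 ha).2).image _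
  refine ⟨hfin.toFinset, ((Finset.range N).filter fun a => ∀ k, (σ ^ (a + N * k)) v ∈ W).image
    fun a => (a, N), ?_, ?_⟩
  · simp only [Finset.mem_image]
    rintro _ ⟨a, _, rfl⟩
    exact hN
  · ext m
    simp only [Set.Finite.coe_toFinset, Set.mem_union, Set.mem_iUnion, Finset.mem_image,
      Finset.mem_filter, Finset.mem_range, Set.mem_image, Set.mem_ofPred_eq]
    constructor
    · intro hm
      have hmod : m % N + N * (m / N) = m := Nat.mod_add_div m N
      have hlt : m % N < N := Nat.mod_lt _ hN
      by_cases hall : ∀ k, (σ ^ (m % N + N * k)) v ∈ W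
      · exact Or.inr ⟨_, ⟨m % N, ⟨hlt, hall⟩, rfl⟩, m / N, hmod.symm⟩
      · exact Or.inl ⟨m % N, ⟨hlt, hall⟩, m / N, by rwa [hmod], hmod⟩
    · rintro (⟨a, _, k, hk, rfl⟩ | ⟨_, ⟨a, ⟨_, hall⟩, rfl⟩, k, rfl⟩)
      · exact hk
      · exact hall k
end

section
/- Let K be a field of characteristic 0, let (f(n)) satisfy a linear recurrence f(n) = Σ_{j=1}^r a_j f(n−j) for n ≥ r with a_j ∈ K and invertible leading behavior (a_r ≠ 0). Then { m ∈ ℕ : f(m) = 0 } is a union of finitely many arithmetic progressions in ℕ and a finite set. -/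
section

open Filter Topology

/-- A nonzero sequence tending to zero has a last term of maximal norm. -/
theorem exists_last_max_norm {E : Type*} [NormedAddCommGroup E] {e : ℕ → E}
    (he : Tendsto e atTop (𝓝 0)) (hne : ∃ k, e k ≠ 0) :
    ∃ N, e N ≠ 0 ∧ (∀ k, ‖e k‖ ≤ ‖e N‖) ∧ ∀ k > N, ‖e k‖ < ‖e N‖ := by
  have hfin (i : ℕ) (hi : e i ≠ 0) : {k | ‖e i‖ ≤ ‖e k‖}.Finite := by
    have h := (tendsto_zero_iff_norm_tendsto_zero.1 he).eventually_lt_const (norm_pos_iff.2 hi)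
    rw [← Nat.cofinite_eq_atTop, eventually_cofinite] at h
    simpa using h
  obtain ⟨i, hi⟩ := hne
  obtain ⟨m, hm, hmax⟩ := Set.exists_max_image _ (fun k ↦ ‖e k‖) (hfin i hi) ⟨i, le_refl ‖e i‖⟩
  have hm0 : e m ≠ 0 := norm_pos_iff.1 ((norm_pos_iff.2 hi).trans_le hm)
  have hm' (k) : ‖e k‖ ≤ ‖e m‖ := by
    by_cases hk : ‖e i‖ ≤ ‖e k‖
    · exact hmax k hk
    · exact (not_le.1 hk).le.trans hm
  obtain ⟨N, hN, hNmax⟩ := Set.exists_max_image _ id (hfin m hm0) ⟨m, le_refl ‖e m‖⟩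
  have hN' : ‖e m‖ ≤ ‖e N‖ := hN
  refine ⟨N, norm_pos_iff.1 ((norm_pos_iff.2 hm0).trans_le hN'), fun k ↦ (hm' k).trans hN',
    fun k hk ↦ ?_⟩
  by_contra! h
  exact (hNmax k (hN'.trans h)).not_gt hk

namespace Polynomial

theorem prod_X_sub_C_natCast_dvd {R : Type*} [CommRing R] [IsDomain R] [CharZero R] {P : R[X]}
    {T : Finset ℕ} (h : ∀ n ∈ T, P.eval (n : R) = 0) : ∏ t ∈ T, (X - C (t : R)) ∣ P := by
  by_cases hP : P = 0
  · simp [hP]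
  have h := (Multiset.prod_X_sub_C_dvd_iff_le_roots hP (T.val.map (Nat.cast : ℕ → R))).2 <| by
    rw [Multiset.le_iff_subset (T.nodup.map Nat.cast_injective)]
    intro x hx
    obtain ⟨n, hn, rfl⟩ := Multiset.mem_map.1 hx
    exact (mem_roots hP).2 (h n hn)
  rwa [Multiset.map_map] at h

theorem monic_sum_descPochhammer {R : Type*} [CommRing R] [IsDomain R]
    (b : ℕ → R) {N : ℕ} (hb : b N = 1) :
    (∑ k ∈ Finset.range (N + 1), C (b k) * descPochhammer R k).Monic ∧
      (∑ k ∈ Finset.range (N + 1), C (b k) * descPochhammer R k).natDegree = N := by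
  have hlt : (∑ k ∈ Finset.range N, C (b k) * descPochhammer R k).degree
      < (descPochhammer R N).degree := by
    have hdeg (k : ℕ) : (descPochhammer R k).degree ≤ k :=
      degree_le_of_natDegree_le (descPochhammer_natDegree R k).le
    rw [degree_eq_natDegree (monic_descPochhammer R N).ne_zero, descPochhammer_natDegree]
    refine (degree_sum_le _ _).trans_lt ((Finset.sup_lt_iff (WithBot.bot_lt_coe N)).2 ?_)
    intro k hk
    rw [← smul_eq_C_mul]
    exact ((degree_smul_le _ _).trans (hdeg k)).trans_lt
      (WithBot.coe_lt_coe.2 (Finset.mem_range.1 hk))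
  rw [Finset.sum_range_succ, hb, C_1, one_mul]
  exact ⟨(monic_descPochhammer R N).add_of_right hlt,
    by rw [natDegree_add_eq_right_of_degree_lt hlt, descPochhammer_natDegree]⟩

end Polynomial

namespace PadicInt

variable {p : ℕ} [hp : Fact p.Prime]

theorem dvd_of_norm_le {x y : ℤ_[p]} (hy : y ≠ 0) (h : ‖x‖ ≤ ‖y‖) : y ∣ x := by
  have hy' : (y : ℚ_[p]) ≠ 0 := by simpa using hy
  refine ⟨⟨x / y, ?_⟩, ?_⟩
  · rw [norm_div]
    exact div_le_one_of_le₀ h (norm_nonneg _)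
  · apply PadicInt.ext
    exact (mul_div_cancel₀ (x : ℚ_[p]) hy').symm

open Polynomial in
/-- A polynomial in the falling factorial basis whose last coefficient not divisible by `p` is
`b N = 1` has at most `N` natural zeros. -/
theorem card_le_of_eval_sum_descPochhammer {b : ℕ → ℤ_[p]} {N M : ℕ} (hNM : N ≤ M)
    (hbN : b N = 1) (hb : ∀ k > N, ‖b k‖ < 1) {T : Finset ℕ}
    (hT : ∀ n ∈ T, ∑ k ∈ Finset.range (M + 1), b k * n.descFactorial k = 0) : T.card ≤ N := by
  let P : ℤ_[p][X] := ∑ k ∈ Finset.range (M + 1), C (b k) * descPochhammer ℤ_[p] k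
  have hdvd : ∏ t ∈ T, (X - C (t : ℤ_[p])) ∣ P := by
    refine prod_X_sub_C_natCast_dvd fun n hn ↦ ?_
    simpa [P, eval_finsetSum, descPochhammer_eval_eq_descFactorial] using hT n hn
  have hmap : P.map toZMod = ∑ k ∈ Finset.range (N + 1),
      C (toZMod (b k)) * descPochhammer (ZMod p) k := by
    rw [Polynomial.map_sum]
    symm
    refine Finset.sum_subset_zero_on_sdiff (Finset.range_mono (by lia)) (fun k hk ↦ ?_)
        fun k hk ↦ ?_
    · simp only [Finset.mem_sdiff, Finset.mem_range] at hk
      have h0 : toZMod (b k) = 0 := by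
        rw [← RingHom.mem_ker, ker_toZMod, IsLocalRing.mem_maximalIdeal, mem_nonunits]
        exact hb k (by lia)
      simp [h0]
    · simp [descPochhammer_map]
  obtain ⟨hmonic, hdeg⟩ := monic_sum_descPochhammer (fun k ↦ toZMod (b k)) (N := N)
    (by simp [hbN])
  by_contra! hlt
  refine Monic.not_dvd_of_natDegree_lt (p := (∏ t ∈ T, (X - C (t : ℤ_[p]))).map toZMod)
    ((monic_prod_X_sub_C _ _).map _) hmonic.ne_zero ?_ (hmap ▸ Polynomial.map_dvd _ hdvd)
  rwa [hdeg, (monic_prod_X_sub_C _ _).natDegree_map, natDegree_finsetProd_X_sub_C_eq_card]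

/-- Strassmann's theorem for series in the falling factorial basis. -/
theorem finite_zeros_newtonSeries {e : ℕ → ℤ_[p]}
    (he : Tendsto e atTop (𝓝 0)) (hne : ∃ k, e k ≠ 0) :
    {n : ℕ | ∑ k ∈ Finset.range (n + 1), e k * n.descFactorial k = 0}.Finite := by
  obtain ⟨N, hN0, hle, hlt⟩ := exists_last_max_norm he hne
  choose b hb using fun k ↦ dvd_of_norm_le hN0 (hle k)
  have hbN : b N = 1 := mul_left_cancel₀ hN0 (by rw [← hb, mul_one])
  have hb1 (k) (hk : N < k) : ‖b k‖ < 1 := by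
    have := hlt k hk
    rw [hb k, norm_mul] at this
    exact lt_of_mul_lt_mul_left (by simpa using this) (norm_nonneg (e N))
  by_contra hinf
  obtain ⟨T, hT, hTcard⟩ := Set.Infinite.exists_subset_card_eq hinf (N + 1)
  refine (card_le_of_eval_sum_descPochhammer (T := T) (Nat.le_add_right N (T.sup id)) hbN hb1
    fun n hn ↦ mul_left_cancel₀ hN0 ?_).not_gt (by lia)
  have hnM : n ≤ T.sup id := Finset.le_sup (f := id) hn
  rw [mul_zero, ← show _ = _ from hT hn, Finset.mul_sum]
  symm
  refine Finset.sum_subset_zero_on_sdiff (Finset.range_mono (by lia)) (fun k hk ↦ ?_)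
    fun k hk ↦ ?_
  · simp only [Finset.mem_sdiff, Finset.mem_range] at hk
    simp [Nat.descFactorial_eq_zero_iff_lt.2 (show n < k by lia)]
  · rw [hb k, mul_assoc]

open Nat in
theorem exists_factorial_mul_eq_pow (hp2 : p ≠ 2) :
    ∃ u : ℕ → ℤ_[p], Tendsto u atTop (𝓝 0) ∧ ∀ k, (k ! : ℤ_[p]) * u k = (p : ℤ_[p]) ^ k := by
  have hp1 : (1 : ℝ) < p := by exact_mod_cast hp.1.one_lt
  have hk0 (k : ℕ) : (k ! : ℤ_[p]) ≠ 0 := by exact_mod_cast k.factorial_ne_zero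
  have hnorm (k : ℕ) : (p : ℝ)⁻¹ ^ k ≤ (p : ℝ)⁻¹ ^ (k / 2) * ‖(k ! : ℤ_[p])‖ := by
    have hval : 2 * padicValNat p k ! ≤ k := by
      have h := sub_one_mul_padicValNat_factorial (p := p) k
      have h3 : 2 ≤ p - 1 := by have := hp.1.two_le; lia
      have := Nat.mul_le_mul_right (padicValNat p k !) h3
      lia
    rw [norm_def, coe_natCast, Padic.norm_eq_zpow_neg_valuation (by exact_mod_cast hk0 k),
      Padic.valuation_natCast, zpow_neg, zpow_natCast, ← inv_pow, ← pow_add]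
    exact pow_le_pow_of_le_one (by positivity) (inv_le_one_of_one_le₀ hp1.le) (by lia)
  have hnp (k : ℕ) : ‖(p : ℤ_[p]) ^ k‖ = (p : ℝ)⁻¹ ^ k := by rw [norm_pow, norm_p]
  have hdvd (k : ℕ) : (k ! : ℤ_[p]) ∣ (p : ℤ_[p]) ^ k := by
    refine dvd_of_norm_le (hk0 k) (hnp k ▸ (hnorm k).trans ?_)
    exact mul_le_of_le_one_left (norm_nonneg _)
      (pow_le_one₀ (by positivity) (inv_le_one_of_one_le₀ hp1.le))
  choose u hu using hdvd
  refine ⟨u, ?_, fun k ↦ (hu k).symm⟩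
  rw [tendsto_zero_iff_norm_tendsto_zero]
  refine squeeze_zero (fun _ ↦ norm_nonneg _) (fun k ↦ ?_)
    ((tendsto_pow_atTop_nhds_zero_of_lt_one (r := (p : ℝ)⁻¹) (by positivity)
      (inv_lt_one_of_one_lt₀ hp1)).comp (Nat.tendsto_div_const_atTop two_ne_zero))
  have h := hnorm k
  rw [← hnp, hu, norm_mul, mul_comm] at h
  exact le_of_mul_le_mul_right h (norm_pos_iff.2 (hk0 k))

/-- A sequence `∑ k, n.choose k * p ^ k * c k` of `p`-adic integers, for odd `p`, vanishes identically
as soon as it has infinitely many zeros. -/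
theorem eq_zero_of_infinite_zeros (hp2 : p ≠ 2) (c : ℕ → ℤ_[p])
    (h : {n : ℕ | ∑ k ∈ Finset.range (n + 1), n.choose k * (p : ℤ_[p]) ^ k * c k = 0}.Infinite)
    (n : ℕ) : ∑ k ∈ Finset.range (n + 1), n.choose k * (p : ℤ_[p]) ^ k * c k = 0 := by
  obtain ⟨u, hu, huk⟩ := exists_factorial_mul_eq_pow hp2
  have key (n k : ℕ) : n.choose k * (p : ℤ_[p]) ^ k * c k = u k * c k * n.descFactorial k := by
    rw [Nat.descFactorial_eq_factorial_mul_choose, ← huk]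
    push_cast
    ring
  simp_rw [key] at h ⊢
  by_contra hn
  refine h (finite_zeros_newtonSeries ?_ ?_)
  · rw [tendsto_zero_iff_norm_tendsto_zero] at hu ⊢
    refine squeeze_zero (fun _ ↦ norm_nonneg _) (fun k ↦ ?_) hu
    rw [norm_mul]
    exact mul_le_of_le_one_right (norm_nonneg _) (norm_le_one _)
  · by_contra! h0
    exact hn (by simp [h0])

theorem finite_quotient_span_p (E : Type*) [CommRing E] [Algebra ℤ_[p] E]
    [Module.Finite ℤ_[p] E] : Finite (E ⧸ Ideal.span {(p : E)}) := by
  let I : Ideal ℤ_[p] := IsLocalRing.maximalIdeal ℤ_[p]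
  have : Finite (ℤ_[p] ⧸ I) := .of_equiv (ZMod p) residueField.symm.toEquiv
  have hI : I.map (algebraMap ℤ_[p] E) = Ideal.span {(p : E)} := by
    simp [I, maximalIdeal_eq_span_p, Ideal.map_span]
  rw [← hI]
  have : Module.Finite (ℤ_[p] ⧸ I) (E ⧸ I.map (algebraMap ℤ_[p] E)) :=
    Module.Finite.of_restrictScalars_finite ℤ_[p] _ _
  exact Module.finite_of_finite (ℤ_[p] ⧸ I)

theorem exists_pow_eq_one_add_p_mul {E : Type*} [CommRing E] [Algebra ℤ_[p] E]
    [Module.Finite ℤ_[p] E] {x : E} (hx : IsUnit x) :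
    ∃ N, 1 ≤ N ∧ ∃ y, x ^ N = 1 + p * y := by
  have := finite_quotient_span_p (p := p) E
  obtain ⟨u, rfl⟩ := hx
  let v := Units.map (Ideal.Quotient.mk (Ideal.span {(p : E)})).toMonoidHom u
  obtain ⟨N, hN, h⟩ := (isOfFinOrder_of_finite v).exists_pow_eq_one
  refine ⟨N, hN, ?_⟩
  have h' : Ideal.Quotient.mk (Ideal.span {(p : E)}) ((u : E) ^ N) =
      Ideal.Quotient.mk (Ideal.span {(p : E)}) 1 := by
    simpa [v] using congrArg Units.val h
  rw [Ideal.Quotient.eq, Ideal.mem_span_singleton] at h'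
  obtain ⟨y, hy⟩ := h'
  exact ⟨y, by rw [← hy]; ring⟩

theorem linearMap_pow_eq_zero_of_infinite (hp2 : p ≠ 2) {E M : Type*} [CommRing E]
    [Algebra ℤ_[p] E] [AddCommGroup M] [Module ℤ_[p] M] [Module.Free ℤ_[p] M]
    (l : E →ₗ[ℤ_[p]] M) (y z : E)
    (h : {n : ℕ | l (z * (1 + p * y) ^ n) = 0}.Infinite) (n : ℕ) :
    l (z * (1 + p * y) ^ n) = 0 := by
  let b := Module.Free.chooseBasis ℤ_[p] M
  have key (i) (n : ℕ) : b.repr (l (z * (1 + p * y) ^ n)) i = ∑ k ∈ Finset.range (n + 1),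
      n.choose k * (p : ℤ_[p]) ^ k * b.repr (l (z * y ^ k)) i := by
    have hexp : z * (1 + p * y) ^ n = ∑ k ∈ Finset.range (n + 1),
        (n.choose k * (p : ℤ_[p]) ^ k) • (z * y ^ k) := by
      rw [add_comm, add_pow, Finset.mul_sum]
      refine Finset.sum_congr rfl fun k _ ↦ ?_
      rw [Algebra.smul_def]
      simp only [map_mul, map_pow, map_natCast, one_pow]
      ring
    simp [hexp]
  rw [← b.repr.map_eq_zero_iff]
  ext i
  rw [key]
  refine eq_zero_of_infinite_zeros hp2 _ (h.mono fun m hm ↦ ?_) n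
  have hm' : l (z * (1 + p * y) ^ m) = 0 := hm
  simp [← key, hm']

theorem _root_.LinearRecurrence.eval₂_charPoly {S T : Type*} [CommRing S] [CommRing T]
    (L : LinearRecurrence S) (f : S →+* T) (x : T) :
    L.charPoly.eval₂ f x = x ^ L.order - ∑ j, f (L.coeffs j) * x ^ (j : ℕ) := by
  simp [LinearRecurrence.charPoly, Polynomial.eval₂_sub, Polynomial.eval₂_finsetSum]

open Polynomial in
/-- For a linear recurrence sequence over a ring that is finite free over `ℤ_[p]` there is a modulus
such that the sequence vanishes on every residue class on which it has infinitely many zeros. -/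
theorem exists_period_of_linearRecurrence (hp2 : p ≠ 2) {S : Type*} [CommRing S] [Nontrivial S]
    [Algebra ℤ_[p] S] [Module.Finite ℤ_[p] S] [Module.Free ℤ_[p] S] {r : ℕ} (hr : 1 ≤ r)
    {a : Fin r → S} {g : ℕ → S} (hrec : ∀ n, g (n + r) = ∑ j : Fin r, a j * g (n + j))
    (ha : IsUnit (a ⟨0, hr⟩)) :
    ∃ N, 1 ≤ N ∧ ∀ i, {n | g (i + N * n) = 0}.Infinite → ∀ n, g (i + N * n) = 0 := by
  let L : LinearRecurrence S := ⟨r, a⟩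
  let q : S[X] := L.charPoly
  have hq : q.Monic := L.charPoly_monic
  have hqdeg : q.natDegree = r := natDegree_eq_of_degree_eq_some L.charPoly_degree_eq_order
  let x : AdjoinRoot q := AdjoinRoot.root q
  have hx : x ^ r = ∑ j : Fin r, AdjoinRoot.of q (a j) * x ^ (j : ℕ) := by
    rw [← sub_eq_zero]
    exact (L.eval₂_charPoly (AdjoinRoot.of q) x).symm.trans (AdjoinRoot.eval₂_root q)
  have hxu : IsUnit x := by
    obtain ⟨r, rfl⟩ := Nat.exists_eq_add_of_le' hr
    rw [Fin.sum_univ_succ, ← sub_eq_iff_eq_add] at hx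
    have h0 : x * (x ^ r - ∑ j : Fin r, AdjoinRoot.of q (a j.succ) * x ^ (j : ℕ)) =
        AdjoinRoot.of q (a 0) := by
      rw [Fin.val_zero, pow_zero, mul_one] at hx
      rw [← hx, mul_sub, Finset.mul_sum, ← pow_succ']
      congr 1
      refine Finset.sum_congr rfl fun j _ ↦ ?_
      rw [Fin.val_succ]
      ring
    exact isUnit_of_mul_isUnit_left (h0 ▸ ha.map (AdjoinRoot.of q))
  have : Module.Finite S (AdjoinRoot q) := hq.finite_adjoinRoot
  have : Module.Finite ℤ_[p] (AdjoinRoot q) := .trans S _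
  let B := (AdjoinRoot.powerBasis' hq).basis
  let l : AdjoinRoot q →ₗ[S] S := B.constr S fun i ↦ g i
  have hl (n : ℕ) : l (x ^ n) = g n := by
    induction n using Nat.strong_induction_on with
    | _ n ih =>
      by_cases hn : n < r
      · have := B.constr_basis S (fun i ↦ g i) ⟨n, by simpa [hqdeg] using hn⟩
        rw [PowerBasis.basis_eq_pow] at this
        exact this
      · obtain ⟨m, rfl⟩ := Nat.exists_eq_add_of_le' (not_lt.1 hn)
        rw [hrec, pow_add, hx, Finset.mul_sum, map_sum]
        refine Finset.sum_congr rfl fun j _ ↦ ?_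
        have h : x ^ m * (AdjoinRoot.of q (a j) * x ^ (j : ℕ)) = a j • x ^ (m + (j : ℕ)) := by
          rw [Algebra.smul_def, pow_add, AdjoinRoot.algebraMap_eq]
          ring
        rw [h, map_smul, smul_eq_mul, ih (m + j) (by lia)]
  obtain ⟨N, hN, y, hy⟩ := exists_pow_eq_one_add_p_mul (p := p) hxu
  refine ⟨N, hN, fun i ↦ ?_⟩
  have hg (n : ℕ) : g (i + N * n) = (l.restrictScalars ℤ_[p]) (x ^ i * (1 + p * y) ^ n) := by
    rw [← hl, pow_add, pow_mul, hy, LinearMap.restrictScalars_apply]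
  simp_rw [hg]
  exact linearMap_pow_eq_zero_of_infinite hp2 _ _ _

end PadicInt

end

/-- Every residue class in `ℤ_[p] ^ ι` contains an algebraically independent family. -/
theorem Padic.exists_algebraicIndependent_near {p : ℕ} [Fact p.Prime] {ι : Type*} [Finite ι]
    (u : ι → ℤ_[p]) :
    ∃ z : ι → ℤ_[p], AlgebraicIndependent ℤ z ∧ ∀ i, ‖z i - u i‖ < 1 := by
  have := Fintype.ofFinite ι
  let U (P : {P : MvPolynomial ι ℤ // P ≠ 0}) : Set (ι → ℚ_[p]) :=
    {z | (MvPolynomial.map (Int.castRingHom ℚ_[p]) P.1).eval z ≠ 0}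
  have hopen (P) : IsOpen (U P) := isOpen_ne_fun (MvPolynomial.continuous_eval _) continuous_const
  have hdense (P) : Dense (U P) := by
    rw [Metric.dense_iff]
    intro z ε hε
    by_contra hempty
    have hzero : MvPolynomial.map (Int.castRingHom ℚ_[p]) P.1 = 0 := by
      refine MvPolynomial.funext_set (fun i ↦ Metric.ball (z i) ε)
        (fun i ↦ infinite_of_mem_nhds (z i) (Metric.ball_mem_nhds _ hε)) fun w hw ↦ ?_
      rw [map_zero]
      by_contra hne
      exact hempty ⟨w, by rwa [← ball_pi _ hε] at hw, hne⟩
    exact P.2 (MvPolynomial.map_injective _ (RingHom.injective_int _) (by simpa using hzero))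
  have : Countable (MvPolynomial ι ℤ) := by
    rw [← Cardinal.mk_le_aleph0_iff]
    exact MvPolynomial.cardinalMk_le_max_lift.trans (by simp)
  have : Countable {P : MvPolynomial ι ℤ // P ≠ 0} := Subtype.countable
  obtain ⟨z, hzu, hz⟩ := Metric.dense_iff.1 (dense_iInter_of_isOpen hopen hdense)
    (fun i ↦ (u i : ℚ_[p])) 1 one_pos
  have hzu' (i) : ‖z i - u i‖ < 1 := by
    rw [← dist_eq_norm]
    exact (dist_le_pi_dist z _ i).trans_lt hzu
  have hz1 (i) : ‖z i‖ ≤ 1 := by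
    have := Padic.nonarchimedean (z i - (u i : ℚ_[p])) (u i : ℚ_[p])
    rw [sub_add_cancel] at this
    exact this.trans (max_le (hzu' i).le (u i).2)
  obtain ⟨z, rfl⟩ : ∃ y : ι → ℤ_[p], (fun i ↦ (y i : ℚ_[p])) = z := ⟨fun i ↦ ⟨z i, hz1 i⟩, rfl⟩
  refine ⟨z, ?_, hzu'⟩
  rw [algebraicIndependent_iff]
  intro P hP
  by_contra hP0
  refine Set.mem_iInter.1 hz ⟨P, hP0⟩ ?_
  rw [MvPolynomial.eval_map]
  have := congrArg (algebraMap ℤ_[p] ℚ_[p]) hP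
  rwa [map_zero, MvPolynomial.aeval_def, MvPolynomial.hom_eval₂,
    RingHom.ext_int ((algebraMap ℤ_[p] ℚ_[p]).comp _) (Int.castRingHom ℚ_[p])] at this

/-- A finite family of nonzero integer polynomials can be evaluated at an algebraically independent
family of `p`-adic integers, for some odd prime `p`, so that their product takes a unit value. -/
theorem MvPolynomial.exists_padicInt_isUnit_aeval {ι : Type*} [Finite ι] {c : MvPolynomial ι ℤ}
    (hc : c ≠ 0) : ∃ (p : ℕ) (_ : Fact p.Prime) (z : ι → ℤ_[p]),
      p ≠ 2 ∧ AlgebraicIndependent ℤ z ∧ IsUnit (aeval z c) := by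
  obtain ⟨u, hu⟩ : ∃ u : ι → ℤ, eval u c ≠ 0 := by
    by_contra! h
    exact hc (MvPolynomial.funext (by simpa using h))
  obtain ⟨p, hpu, hp⟩ := Nat.exists_infinite_primes ((eval u c).natAbs + 3)
  have : Fact p.Prime := ⟨hp⟩
  obtain ⟨z, hz, hzu⟩ := Padic.exists_algebraicIndependent_near fun i ↦ (u i : ℤ_[p])
  refine ⟨p, this, z, by lia, hz, ?_⟩
  have hzu' (i) : PadicInt.toZMod (z i) = (u i : ZMod p) := by
    rw [← sub_eq_zero, ← map_intCast (PadicInt.toZMod (p := p)), ← map_sub, ← RingHom.mem_ker,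
      PadicInt.ker_toZMod, IsLocalRing.mem_maximalIdeal, PadicInt.mem_nonunits]
    exact hzu i
  have hval : PadicInt.toZMod (aeval z c) = ((eval u c : ℤ) : ZMod p) := by
    rw [aeval_def, hom_eval₂, eval, ← eq_intCast (Int.castRingHom (ZMod p)), coe_eval₂Hom,
      hom_eval₂]
    congr 1
    · exact RingHom.ext_int _ _
    · ext i
      simp [hzu']
  by_contra hunit
  rw [← mem_nonunits_iff, ← IsLocalRing.mem_maximalIdeal, ← PadicInt.ker_toZMod, RingHom.mem_ker,
    hval, ZMod.intCast_zmod_eq_zero_iff_dvd, Int.natCast_dvd] at hunit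
  have := Nat.le_of_dvd (Int.natAbs_pos.2 hu) hunit
  lia

open Polynomial in
/-- A finitely generated domain of characteristic zero embeds in an integral domain that is finite
over `ℤ_[p]`, for some odd prime `p`. -/
theorem exists_injective_ringHom_finite_padicInt {R : Type*} [CommRing R] [IsDomain R] [CharZero R]
    {s : Set R} (hs : s.Finite) (hsR : Algebra.adjoin ℤ s = ⊤) :
    ∃ (p : ℕ) (_ : Fact p.Prime) (S : Subalgebra ℤ_[p] (AlgebraicClosure ℚ_[p])) (φ : R →+* S),
      p ≠ 2 ∧ Module.Finite ℤ_[p] S ∧ Function.Injective φ := by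
  have : Algebra.IsAlgebraic (Algebra.adjoin ℤ s) R := by
    refine ⟨fun x ↦ ?_⟩
    have hx : x ∈ Algebra.adjoin ℤ s := hsR ▸ Algebra.mem_top
    exact isAlgebraic_algebraMap (⟨x, hx⟩ : Algebra.adjoin ℤ s)
  obtain ⟨t, hts, ht⟩ := exists_isTranscendenceBasis_subset (R := ℤ) s
  have : Finite t := hs.subset hts
  let B := MvPolynomial t ℤ
  let _ : Algebra B R := (MvPolynomial.aeval (R := ℤ) ((↑) : t → R)).toAlgebra
  have halg (x : R) : IsAlgebraic B x := by
    let e := ht.1.aevalEquiv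
    refine (ht.isAlgebraic.isAlgebraic x).of_ringHom_of_comp_eq (e : B →+* _) (RingHom.id R)
      e.surjective Function.injective_id ?_
    ext y
    · simp
    · have h : algebraMap B R (MvPolynomial.X y) = y :=
        MvPolynomial.aeval_X (R := ℤ) ((↑) : t → R) y
      simp [e, h]
  have : Algebra.IsAlgebraic B R := ⟨halg⟩
  have : FaithfulSMul B R := (faithfulSMul_iff_algebraMap_injective B R).2 ht.1
  choose P hP0 hP using fun x ↦ halg x
  have hc : ∏ y ∈ hs.toFinset, (P y).leadingCoeff ≠ 0 :=
    Finset.prod_ne_zero_iff.2 fun y _ ↦ leadingCoeff_ne_zero.2 (hP0 y)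
  obtain ⟨p, hp, z, hp2, hz, hunit⟩ := MvPolynomial.exists_padicInt_isUnit_aeval hc
  let Ω := AlgebraicClosure ℚ_[p]
  let ψ : B →+* ℤ_[p] := (MvPolynomial.aeval z).toRingHom
  have hΩ : Function.Injective (algebraMap ℤ_[p] Ω) := by
    rw [IsScalarTower.algebraMap_eq ℤ_[p] ℚ_[p] Ω]
    exact (algebraMap ℚ_[p] Ω).injective.comp (IsFractionRing.injective ℤ_[p] ℚ_[p])
  have hψ : Function.Injective ((algebraMap ℤ_[p] Ω).comp ψ) := hΩ.comp hz
  let _ : Algebra B Ω := ((algebraMap ℤ_[p] Ω).comp ψ).toAlgebra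
  have : FaithfulSMul B Ω := (faithfulSMul_iff_algebraMap_injective B Ω).2 hψ
  let φ : R →ₐ[B] Ω := IsAlgClosed.lift
  have hφ : Function.Injective φ := by
    rw [← AlgHom.coe_toRingHom, RingHom.injective_iff_ker_eq_bot]
    by_contra hker
    obtain ⟨x, hx, hx0⟩ := Submodule.exists_mem_ne_zero_of_ne_bot hker
    refine Ideal.comap_ne_bot_of_algebraic_mem hx0 hx (halg x) ?_
    rw [RingHom.comap_ker, ← RingHom.injective_iff_ker_eq_bot]
    have h : (φ : R →+* Ω).comp (algebraMap B R) = (algebraMap ℤ_[p] Ω).comp ψ := φ.comp_algebraMap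
    rwa [h]
  have hint (y) (hy : y ∈ s) : IsIntegral ℤ_[p] (φ y) := by
    have hlc : IsUnit (ψ (P y).leadingCoeff) := by
      refine isUnit_of_dvd_unit (map_dvd ψ ?_) hunit
      exact Finset.dvd_prod_of_mem (fun y ↦ (P y).leadingCoeff) (hs.mem_toFinset.2 hy)
    have hroot : aeval (φ y) ((P y).map ψ) = 0 := by
      rw [aeval_def, eval₂_map]
      have := congrArg φ (hP y)
      rwa [map_zero, ← aeval_algHom_apply] at this
    have h := isIntegral_leadingCoeff_smul _ _ hroot
    rw [leadingCoeff_map_of_leadingCoeff_ne_zero _ hlc.ne_zero] at h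
    simpa [smul_smul] using h.smul ((hlc.unit⁻¹ : ℤ_[p]ˣ) : ℤ_[p])
  let S := Algebra.adjoin ℤ_[p] (φ '' s)
  have hS (x : R) : φ x ∈ S := by
    have hx : x ∈ Algebra.adjoin ℤ s := hsR ▸ Algebra.mem_top
    induction hx using Algebra.adjoin_induction with
    | mem x hx => exact Algebra.subset_adjoin ⟨x, hx, rfl⟩
    | algebraMap n => simp
    | add x y _ _ hx hy => rw [map_add]; exact add_mem hx hy
    | mul x y _ _ hx hy => rw [map_mul]; exact mul_mem hx hy
  refine ⟨p, hp, S, φ.toRingHom.codRestrict S hS, hp2,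
    Algebra.finite_adjoin_of_finite_of_isIntegral (hs.image φ) ?_, fun x y hxy ↦ hφ ?_⟩
  · rintro _ ⟨y, hy, rfl⟩
    exact hint y hy
  · exact congrArg Subtype.val hxy

/-- For a linear recurrence sequence over a field of characteristic zero there is a modulus such that
the sequence vanishes on every residue class on which it has infinitely many zeros. -/
theorem exists_period_of_linearRecurrence {K : Type*} [Field K] [CharZero K] {r : ℕ} (hr : 1 ≤ r)
    {a : Fin r → K} {f : ℕ → K} (hrec : ∀ n, f (n + r) = ∑ j : Fin r, a j * f (n + j))
    (ha : a ⟨0, hr⟩ ≠ 0) :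
    ∃ N, 1 ≤ N ∧ ∀ i, {n | f (i + N * n) = 0}.Infinite → ∀ n, f (i + N * n) = 0 := by
  let s : Set K := Set.range a ∪ f '' Set.Iio r ∪ {(a ⟨0, hr⟩)⁻¹}
  have hs : s.Finite :=
    ((Set.finite_range a).union ((Set.finite_Iio r).image f)).union (Set.finite_singleton _)
  let R := Algebra.adjoin ℤ s
  have haR (j) : a j ∈ R := Algebra.subset_adjoin (.inl (.inl ⟨j, rfl⟩))
  have hbR : (a ⟨0, hr⟩)⁻¹ ∈ R := Algebra.subset_adjoin (.inr rfl)
  have hfR (n) : f n ∈ R := by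
    induction n using Nat.strong_induction_on with
    | _ n ih =>
      by_cases hn : n < r
      · exact Algebra.subset_adjoin (.inl (.inr ⟨n, hn, rfl⟩))
      · obtain ⟨m, rfl⟩ := Nat.exists_eq_add_of_le' (not_lt.1 hn)
        rw [hrec]
        exact sum_mem fun j _ ↦ mul_mem (haR j) (ih _ (by lia))
  obtain ⟨p, hp, S, φ, hp2, hfin, hφ⟩ := exists_injective_ringHom_finite_padicInt
    (R := R) (hs.preimage Subtype.val_injective.injOn) Algebra.adjoin_adjoin_coe_preimage
  have hS : Function.Injective (algebraMap ℤ_[p] (AlgebraicClosure ℚ_[p])) := by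
    rw [IsScalarTower.algebraMap_eq ℤ_[p] ℚ_[p]]
    exact (algebraMap ℚ_[p] _).injective.comp (IsFractionRing.injective ℤ_[p] ℚ_[p])
  have : FaithfulSMul ℤ_[p] (AlgebraicClosure ℚ_[p]) :=
    (faithfulSMul_iff_algebraMap_injective _ _).2 hS
  obtain ⟨N, hN, h⟩ := PadicInt.exists_period_of_linearRecurrence hp2 hr
    (a := fun j ↦ φ ⟨a j, haR j⟩) (g := fun n ↦ φ ⟨f n, hfR n⟩)
    (fun n ↦ by
      simp_rw [← map_mul, ← map_sum]
      congr 1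
      ext
      simpa using hrec n)
    (.map φ (.of_mul_eq_one ⟨_, hbR⟩ (Subtype.ext (mul_inv_cancel₀ ha))))
  have hzero (n) : φ ⟨f n, hfR n⟩ = 0 ↔ f n = 0 := by
    rw [map_eq_zero_iff φ hφ, ← Subtype.val_inj]
    rfl
  simp_rw [hzero] at h
  exact ⟨N, hN, h⟩

/-- The Skolem–Mahler–Lech theorem: the zero set of a linear recurrence sequence over a
field of characteristic zero (with nonzero last coefficient) is a union of finitely many
arithmetic progressions and a finite set. -/
theorem stmt9 (K : Type*) [Field K] [CharZero K] (r : ℕ) (hr : 1 ≤ r)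
    (a : Fin r → K) (f : ℕ → K)
    (hrec : ∀ n : ℕ, f (n + r) = ∑ j : Fin r, a j * f (n + j))
    (ha : a ⟨0, hr⟩ ≠ 0) :
    ∃ (Fs : Finset ℕ) (P : Finset (ℕ × ℕ)), (∀ q ∈ P, 1 ≤ q.2) ∧
      {m : ℕ | f m = 0} = ↑Fs ∪ ⋃ q ∈ P, {x : ℕ | ∃ d : ℕ, x = q.1 + q.2 * d} := by
  classical
  obtain ⟨N, hN, h⟩ := exists_period_of_linearRecurrence hr hrec ha
  have hfin : {m | f m = 0 ∧ ¬ ∀ n, f (m % N + N * n) = 0}.Finite := by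
    have hi (i : ℕ) : {n | f (i + N * n) = 0 ∧ ¬ ∀ n, f (i + N * n) = 0}.Finite := by
      by_contra hinf
      have hi := h i (Set.Infinite.mono (fun _ hm ↦ hm.1) hinf)
      exact hinf (Set.finite_empty.subset fun n hn ↦ hn.2 hi)
    refine ((Set.finite_Iio N).biUnion fun i _ ↦ (hi i).image (i + N * ·)).subset fun m hm ↦ ?_
    have hm' : m % N + N * (m / N) = m := Nat.mod_add_div m N
    exact Set.mem_biUnion (Nat.mod_lt m hN) ⟨m / N, by simpa [hm'] using hm, hm'⟩
  refine ⟨hfin.toFinset, ({i ∈ Finset.range N | ∀ n, f (i + N * n) = 0}).image (·, N), ?_, ?_⟩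
  · rintro q hq
    obtain ⟨i, -, rfl⟩ := Finset.mem_image.1 hq
    exact hN
  · ext m
    simp only [Set.mem_ofPred_eq, Set.mem_union, Set.Finite.coe_toFinset, Finset.mem_image,
      Finset.mem_filter, Finset.mem_range, Set.mem_iUnion, exists_prop]
    constructor
    · intro hm
      by_cases hall : ∀ n, f (m % N + N * n) = 0
      · exact .inr ⟨_, ⟨m % N, ⟨Nat.mod_lt m hN, hall⟩, rfl⟩, m / N, (Nat.mod_add_div m N).symm⟩
      · exact .inl ⟨hm, hall⟩
    · rintro (hm | ⟨_, ⟨i, ⟨-, hall⟩, rfl⟩, d, rfl⟩)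
      exacts [hm.1, hall d]
end

section
/- Let K be a field of characteristic 0, q ∈ K^n, σ a polynomial automorphism of affine n-space over K, and X ⊆ 𝔸^n_K a closed subvariety. Then { m ∈ ℤ : σ^m(q) ∈ X } is a union of finitely many complete doubly-infinite arithmetic progressions { a + jm : m ∈ ℤ } (j ≥ 1) and a finite set. -/
/-- A polynomial with enough roots, all of whose higher coefficients are divisible by `π`, takes
only values divisible by `π`. -/
theorem Polynomial.dvd_eval_of_card_roots {B : Type*} [CommRing B] [IsDomain B] (π : B) (x : B)
    (Z : Finset B) : ∀ P : Polynomial B, (∀ z ∈ Z, P.eval z = 0) →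
      (∀ j, Z.card ≤ j → π ∣ P.coeff j) → π ∣ P.eval x := by
  classical
  induction Z using Finset.induction_on with
  | empty =>
    intro P _ hc
    rw [Polynomial.eval_eq_sum_range]
    exact Finset.dvd_sum fun i _ => (hc i (by simp)).mul_right _
  | insert t Z ht ih =>
    intro P hZ hc
    obtain ⟨R, rfl⟩ := Polynomial.dvd_iff_isRoot.2 (hZ t (Finset.mem_insert_self _ _))
    rw [Finset.card_insert_of_notMem ht] at hc
    rw [Polynomial.eval_mul]
    refine (ih R (fun z hz => ?_) ?_).mul_left _
    · have := hZ z (Finset.mem_insert_of_mem hz)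
      rw [Polynomial.eval_mul] at this
      refine (mul_eq_zero.1 this).resolve_left ?_
      simp only [Polynomial.eval_sub, Polynomial.eval_X, Polynomial.eval_C, sub_ne_zero]
      rintro rfl
      exact ht hz
    · have key : ∀ j, Z.card ≤ j → π ∣ R.coeff (j + 1) → π ∣ R.coeff j := by
        intro j hj h
        have h' := hc (j + 1) (by omega)
        rw [sub_mul, Polynomial.coeff_sub, Polynomial.coeff_X_mul, Polynomial.coeff_C_mul] at h'
        exact (dvd_sub_left (h.mul_left t)).1 h'
      intro j hj
      rcases le_total (R.natDegree + 1) j with h | h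
      · rw [Polynomial.coeff_eq_zero_of_natDegree_lt (by omega)]
        exact dvd_zero _
      · induction h using Nat.decreasingInduction with
        | self => rw [Polynomial.coeff_eq_zero_of_natDegree_lt (by omega)]; exact dvd_zero _
        | of_succ k _ ihk => exact key k hj (ihk (by omega))

/-- Lemma of Hansel: a sequence given by a rapidly decreasing binomial series that vanishes
infinitely often vanishes identically. -/
theorem eq_zero_of_infinite_zeros_of_binomial_series {B : Type*} [CommRing B] [IsDomain B]
    [CharZero B] (π : B) (hfac : ∀ i : ℕ, ∃ c : B, π ^ i = i.factorial * (π ^ ((i + 1) / 2) * c))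
    (hsep : ∀ x : B, (∀ k : ℕ, π ^ k ∣ x) → x = 0) (b d : ℕ → B)
    (hb : ∀ m : ℕ, b m = ∑ k ∈ Finset.range (m + 1), (m.choose k : B) * (π ^ k * d k))
    (hinf : {m : ℕ | b m = 0}.Infinite) (m : ℕ) : b m = 0 := by
  classical
  choose c hc using hfac
  refine hsep _ fun k => ?_
  obtain ⟨Z, hZ, hcard⟩ := hinf.exists_subset_card_eq (2 * k)
  set N := m + Z.sup id + 1 with hN
  set P : Polynomial B := ∑ i ∈ Finset.range N,
    Polynomial.C (π ^ ((i + 1) / 2) * c i * d i) * descPochhammer B i with hP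
  have heval : ∀ j < N, P.eval (j : B) = b j := by
    intro j hj
    rw [hb, hP, Polynomial.eval_finsetSum]
    symm
    refine (Finset.sum_subset (s₂ := Finset.range N) ?_ ?_).trans ?_
    · exact fun i hi => Finset.mem_range.2 (by have := Finset.mem_range.1 hi; omega)
    · intro i _ hi
      rw [Nat.choose_eq_zero_of_lt (by simpa using hi)]
      simp
    · refine Finset.sum_congr rfl fun i _ => ?_
      rw [Polynomial.eval_mul, Polynomial.eval_C, descPochhammer_eval_eq_descFactorial,
        Nat.descFactorial_eq_factorial_mul_choose, hc i]
      push_cast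
      ring
  rw [← heval m (by omega)]
  refine Polynomial.dvd_eval_of_card_roots _ _ (Z.image (Nat.cast : ℕ → B)) P ?_ ?_
  · intro z hz
    obtain ⟨j, hj, rfl⟩ := Finset.mem_image.1 hz
    have : j ≤ Z.sup id := Finset.le_sup (f := id) hj
    rw [heval j (by omega)]
    exact hZ hj
  · intro j hj
    rw [Finset.card_image_of_injective _ Nat.cast_injective, hcard] at hj
    rw [hP, Polynomial.finsetSum_coeff]
    refine Finset.dvd_sum fun i _ => ?_
    rw [Polynomial.coeff_C_mul]
    rcases lt_or_ge i j with h | h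
    · rw [Polynomial.coeff_eq_zero_of_natDegree_lt (by rwa [descPochhammer_natDegree]), mul_zero]
      exact dvd_zero _
    · rw [mul_assoc, mul_assoc]
      exact (pow_dvd_pow π (by omega)).mul_right _

/-- The powers of an endomorphism congruent to the identity modulo `π` are given by a
`π`-adically decreasing binomial series. -/
theorem Module.End.exists_binomial_series {B A : Type*} [CommRing B] [AddCommGroup A] [Module B A]
    (π : B) (T : Module.End B A) (hT : ∀ g, ∃ g', T g = g + π • g') (g : A) :
    ∃ d : ℕ → A, ∀ m : ℕ, (T ^ m) g =
      ∑ k ∈ Finset.range (m + 1), (m.choose k : B) • π ^ k • d k := by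
  have h : ∀ k : ℕ, ∃ d, ((T - 1) ^ k) g = π ^ k • d := by
    intro k
    induction k with
    | zero => exact ⟨g, by simp⟩
    | succ k ih =>
      obtain ⟨d, hd⟩ := ih
      obtain ⟨d', hd'⟩ := hT d
      refine ⟨d', ?_⟩
      rw [pow_succ', Module.End.mul_apply, hd, map_smul, LinearMap.sub_apply, hd']
      simp [smul_smul, pow_succ]
  choose d hd using h
  refine ⟨d, fun m => ?_⟩
  have := (Commute.one_right (T - 1)).add_pow m
  rw [sub_add_cancel] at this
  rw [this, LinearMap.sum_apply]
  refine Finset.sum_congr rfl fun k _ => ?_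
  rw [one_pow, mul_one, ← Nat.cast_comm, Module.End.mul_apply, hd]
  simpa [Nat.cast_smul_eq_nsmul] using smul_comm _ _ _

namespace MvPolynomial

variable {B : Type*} [CommRing B] {ι : Type*}

/-- The self-map of affine space given by a tuple of polynomials. -/
noncomputable def evalMap (F : ι → MvPolynomial ι B) (x : ι → B) : ι → B := fun i => eval x (F i)

theorem eval_iterate_bind₁ (F : ι → MvPolynomial ι B) (x : ι → B) (k : ℕ) :
    ∀ f : MvPolynomial ι B, eval x ((bind₁ F)^[k] f) = eval ((evalMap F)^[k] x) f := by
  induction k with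
  | zero => simp
  | succ k ih =>
    intro f
    rw [Function.iterate_succ_apply, ih, Function.iterate_succ_apply']
    simp only [eval, eval₂Hom_bind₁]
    rfl

theorem map_evalMap {C : Type*} [CommRing C] (φ : B →+* C) (F : ι → MvPolynomial ι B)
    (x : ι → B) : evalMap (fun i => map φ (F i)) (φ ∘ x) = φ ∘ evalMap F x := by
  funext i
  simp only [evalMap, Function.comp_apply, eval_map, eval₂_comp]

/-- The substitution blowing up the residue disc of radius `π` around `x`. -/
noncomputable def discSubst (π : B) (x : ι → B) : MvPolynomial ι B →ₐ[B] MvPolynomial ι B :=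
  aeval fun i => C (x i) + C π * X i

theorem eval_discSubst (π : B) (x y : ι → B) (f : MvPolynomial ι B) :
    eval y (discSubst π x f) = eval (fun i => x i + π * y i) f := by
  have : (eval y).comp (discSubst π x : MvPolynomial ι B →ₐ[B] MvPolynomial ι B).toRingHom
      = eval fun i => x i + π * y i := by
    apply ringHom_ext <;> intros <;> simp [discSubst]
  exact congrArg (fun g : MvPolynomial ι B →+* B => g f) this

theorem exists_discSubst_eq [Fintype ι] (π : B) (x : ι → B) (f : MvPolynomial ι B) :
    ∃ (c : B) (l : ι → B) (u : MvPolynomial ι B),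
      discSubst π x f = C c + C π * ∑ j, C (l j) * X j + C (π ^ 2) * u := by
  classical
  induction f using MvPolynomial.induction_on with
  | C a => exact ⟨a, 0, 0, by simp [discSubst]⟩
  | add f g hf hg =>
    obtain ⟨c, l, u, h⟩ := hf
    obtain ⟨c', l', u', h'⟩ := hg
    refine ⟨c + c', l + l', u + u', ?_⟩
    simp only [map_add, h, h', Pi.add_apply, add_mul, Finset.sum_add_distrib]
    ring
  | mul_X f i hf =>
    obtain ⟨c, l, u, h⟩ := hf
    refine ⟨c * x i, fun j => l j * x i + if j = i then c else 0,
      u * (C (x i) + C π * X i) + (∑ j, C (l j) * X j) * X i, ?_⟩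
    have hs : ∑ j, C (l j * x i + if j = i then c else 0) * X j
        = (∑ j, C (l j) * X j) * C (x i) + C c * (X i : MvPolynomial ι B) := by
      simp only [map_add, map_mul, add_mul, Finset.sum_add_distrib, Finset.sum_mul]
      congr 1
      · exact Finset.sum_congr rfl fun j _ => by ring
      · rw [Finset.sum_eq_single i] <;> simp +contextual
    rw [map_mul, h, hs]
    simp only [discSubst, aeval_X, map_mul, map_pow]
    ring

theorem exists_discSubst_iterate_eq [Fintype ι] (π : B) (F : ι → MvPolynomial ι B) (J : ℕ)
    (hJ : ∀ x i, π ^ 2 ∣ (evalMap F)^[J] x i - x i) (x : ι → B) (i : ι) :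
    ∃ E : MvPolynomial ι B,
      discSubst π x ((bind₁ F)^[J] (X i)) = C (x i) + C π * (X i + C π * E) := by
  classical
  obtain ⟨c, l, u, h⟩ := exists_discSubst_eq π x ((bind₁ F)^[J] (X i))
  have hev : ∀ y : ι → B, ∃ a, c + π * ∑ j, l j * y j = x i + π * y i + π ^ 2 * a := by
    intro y
    have h' := congrArg (eval y) h
    rw [eval_discSubst, eval_iterate_bind₁, eval_X] at h'
    obtain ⟨a, ha⟩ := hJ (fun i => x i + π * y i) i
    rw [h'] at ha
    simp only [map_add, map_mul, eval_C, map_sum, eval_X, map_pow] at ha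
    exact ⟨a - eval y u, by linear_combination ha⟩
  obtain ⟨a, ha⟩ := hev 0
  have hl : ∀ j, ∃ b, π * l j = (if j = i then π else 0) + π ^ 2 * b := by
    intro j
    obtain ⟨b, hb⟩ := hev (Pi.single j 1)
    refine ⟨b - a, ?_⟩
    simp only [Pi.zero_apply, mul_zero, Finset.sum_const_zero] at ha
    simp only [Pi.single_apply, mul_ite, mul_one, mul_zero, Finset.sum_ite_eq', Finset.mem_univ,
      if_true, eq_comm (a := i)] at hb
    linear_combination hb - ha
  choose b hb using hl
  refine ⟨C a + ∑ j, C (b j) * X j + u, ?_⟩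
  have hs : C π * ∑ j, C (l j) * X j
      = C π * X i + C (π ^ 2) * ∑ j, C (b j) * (X j : MvPolynomial ι B) := by
    have : ∀ j, C π * (C (l j) * X j)
        = (if j = i then C π * X j else 0) + C (π ^ 2) * (C (b j) * (X j : MvPolynomial ι B)) := by
      intro j
      rw [← mul_assoc, ← map_mul, hb, map_add, add_mul, map_mul, mul_assoc]
      split_ifs <;> simp
    rw [Finset.mul_sum, Finset.sum_congr rfl fun j _ => this j, Finset.sum_add_distrib,
      Finset.mul_sum]
    simp
  simp only [Pi.zero_apply, mul_zero, Finset.sum_const_zero, add_zero] at ha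
  rw [h, hs, ha]
  simp only [map_add, map_mul, map_pow]
  ring

theorem exists_aeval_eq_add_smul (π : B) (E : ι → MvPolynomial ι B) (g : MvPolynomial ι B) :
    ∃ g', aeval (fun i => X i + C π * E i) g = g + π • g' := by
  induction g using MvPolynomial.induction_on with
  | C a => exact ⟨0, by simp⟩
  | add f g hf hg =>
    obtain ⟨u, hu⟩ := hf
    obtain ⟨v, hv⟩ := hg
    exact ⟨u + v, by rw [map_add, hu, hv, smul_add]; ring⟩
  | mul_X f i hf =>
    obtain ⟨u, hu⟩ := hf
    refine ⟨u * X i + f * E i + π • (u * E i), ?_⟩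
    rw [map_mul, hu, aeval_X]
    simp only [smul_eq_C_mul]
    ring

theorem exists_binomial_series_eval_iterate [Fintype ι] (π : B) (F : ι → MvPolynomial ι B) (J : ℕ)
    (hJ : ∀ x i, π ^ 2 ∣ (evalMap F)^[J] x i - x i) (x : ι → B) (f : MvPolynomial ι B) :
    ∃ d : ℕ → B, ∀ m : ℕ, eval ((evalMap F)^[J * m] x) f =
      ∑ k ∈ Finset.range (m + 1), (m.choose k : B) * (π ^ k * d k) := by
  choose E hE using exists_discSubst_iterate_eq π F J hJ x
  set T : MvPolynomial ι B →ₐ[B] MvPolynomial ι B := aeval fun i => X i + C π * E i with hT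
  have hS : ∀ k, ((bind₁ F)^[k] : MvPolynomial ι B → MvPolynomial ι B) = ⇑((bind₁ F) ^ k) := by
    intro k
    induction k with
    | zero => rfl
    | succ k ih => rw [Function.iterate_succ, ih, pow_succ]; rfl
  have hconj : (discSubst π x).comp ((bind₁ F) ^ J) = T.comp (discSubst π x) := by
    apply algHom_ext
    intro i
    rw [AlgHom.comp_apply, ← hS, hE, AlgHom.comp_apply]
    simp [discSubst, hT]
  have hiter : ∀ m g, discSubst π x ((bind₁ F)^[J * m] g) = (T.toLinearMap ^ m) (discSubst π x g) := by
    intro m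
    induction m with
    | zero => intro g; simp
    | succ m ih =>
      intro g
      rw [Nat.mul_succ, Function.iterate_add_apply, ih, pow_succ, Module.End.mul_apply, hS J]
      exact congrArg _ (DFunLike.congr_fun hconj g)
  obtain ⟨d, hd⟩ := Module.End.exists_binomial_series π T.toLinearMap
    (exists_aeval_eq_add_smul π E) (discSubst π x f)
  refine ⟨fun k => eval 0 (d k), fun m => ?_⟩
  have h := eval_discSubst π x 0 ((bind₁ F)^[J * m] f)
  rw [hiter, hd, map_sum, eval_iterate_bind₁] at h
  simp only [Pi.zero_apply, mul_zero, add_zero, smul_eval] at h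
  exact h.symm

theorem sq_dvd_iterate_evalMap_sub [Finite ι] (π : B) [Finite (B ⧸ Ideal.span {π ^ 2})]
    (F G : ι → MvPolynomial ι B) (hGF : ∀ i, bind₁ F (G i) = X i) (x : ι → B) (i : ι) :
    π ^ 2 ∣ (evalMap F)^[Nat.card (Equiv.Perm (ι → B ⧸ Ideal.span {π ^ 2}))] x i - x i := by
  set φ := Ideal.Quotient.mk (Ideal.span {π ^ 2})
  set F' := fun i => map φ (F i)
  have hinj : Function.Injective (evalMap F') := by
    refine Function.LeftInverse.injective (g := evalMap fun i => map φ (G i)) fun y => ?_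
    funext j
    have h := congrArg (fun q => eval y (map φ q)) (hGF j)
    simp only [map_bind₁, map_X, eval_X] at h
    have h' := eval_iterate_bind₁ F' y 1 (map φ (G j))
    exact h'.symm.trans h
  set P : Equiv.Perm (ι → B ⧸ Ideal.span {π ^ 2}) :=
    Equiv.ofBijective _ (Finite.injective_iff_bijective.1 hinj)
  have hP : ∀ k y, φ ∘ (evalMap F)^[k] y = (P ^ k) (φ ∘ y) := by
    intro k
    induction k with
    | zero => intro y; rfl
    | succ k ih =>
      intro y
      rw [Function.iterate_succ_apply, ih, pow_succ P k, Equiv.Perm.mul_apply, ← map_evalMap]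
      rfl
  have h := congrFun (hP (Nat.card (Equiv.Perm (ι → B ⧸ Ideal.span {π ^ 2}))) x) i
  rw [pow_card_eq_one', Equiv.Perm.one_apply] at h
  exact Ideal.mem_span_singleton.1 (Ideal.Quotient.eq.1 h)

/-- The zeros of a polynomial along one residue class of an orbit: once there are infinitely many
in the forward direction, the polynomial vanishes on the whole forward half. -/
theorem eval_iterate_eq_zero_of_infinite [IsDomain B] [CharZero B] [Fintype ι] (π : B)
    (hfac : ∀ i : ℕ, ∃ c : B, π ^ i = i.factorial * (π ^ ((i + 1) / 2) * c))
    (hsep : ∀ x : B, (∀ k : ℕ, π ^ k ∣ x) → x = 0) (F : ι → MvPolynomial ι B) (J : ℕ)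
    (hJ : ∀ x i, π ^ 2 ∣ (evalMap F)^[J] x i - x i) (x : ι → B) (f : MvPolynomial ι B)
    (hinf : {m : ℕ | eval ((evalMap F)^[J * m] x) f = 0}.Infinite) (m : ℕ) :
    eval ((evalMap F)^[J * m] x) f = 0 := by
  obtain ⟨d, hd⟩ := exists_binomial_series_eval_iterate π F J hJ x f
  exact eq_zero_of_infinite_zeros_of_binomial_series π hfac hsep _ d hd hinf m

end MvPolynomial

theorem Int.infinite_nat_or_infinite_nat_neg {T : Set ℤ} (hT : T.Infinite) :
    {k : ℕ | (k : ℤ) ∈ T}.Infinite ∨ {k : ℕ | -(k : ℤ) ∈ T}.Infinite := by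
  by_contra! h
  refine hT (((h.1.image fun k : ℕ => (k : ℤ)).union (h.2.image fun k : ℕ => -(k : ℤ))).subset ?_)
  intro m hm
  obtain ⟨k, rfl | rfl⟩ := m.eq_nat_or_neg
  · exact Or.inl ⟨k, hm, rfl⟩
  · exact Or.inr ⟨k, hm, rfl⟩

/-- A set of integers is everything as soon as it is infinite, provided every half-line meeting it
infinitely often is contained in it. -/
theorem Int.mem_of_infinite {T : Set ℤ} (hT : T.Infinite)
    (hpos : ∀ a : ℤ, {k : ℕ | a + k ∈ T}.Infinite → ∀ k : ℕ, a + k ∈ T)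
    (hneg : ∀ a : ℤ, {k : ℕ | a - k ∈ T}.Infinite → ∀ k : ℕ, a - k ∈ T) (m : ℤ) : m ∈ T := by
  rcases Int.infinite_nat_or_infinite_nat_neg hT with h | h
  · have h' : {k : ℕ | (m - m.natAbs) + (k : ℤ) ∈ T}.Infinite := by
      have := h.to_subtype
      refine Set.infinite_of_injective_forall_mem (f := fun j : {k : ℕ | (k : ℤ) ∈ T} =>
        (j : ℕ) + (m.natAbs - m).toNat) ?_ ?_
      · intro i j hij
        exact Subtype.ext (by simpa using hij)
      · rintro ⟨k, hk⟩
        have : (m - m.natAbs) + ((k + (m.natAbs - m).toNat : ℕ) : ℤ) = k := by omega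
        rw [Set.mem_ofPred_eq, this]
        exact hk
    simpa using hpos _ h' m.natAbs
  · have h' : {k : ℕ | (m + m.natAbs) - (k : ℤ) ∈ T}.Infinite := by
      have := h.to_subtype
      refine Set.infinite_of_injective_forall_mem (f := fun j : {k : ℕ | -(k : ℤ) ∈ T} =>
        (j : ℕ) + (m.natAbs + m).toNat) ?_ ?_
      · intro i j hij
        exact Subtype.ext (by simpa using hij)
      · rintro ⟨k, hk⟩
        have : (m + m.natAbs) - ((k + (m.natAbs + m).toNat : ℕ) : ℤ) = -k := by omega
        rw [Set.mem_ofPred_eq, this]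
        exact hk
    simpa using hneg _ h' m.natAbs

/-- A set of integers each of whose residue classes modulo `J` is finite or full is a finite union
of complete arithmetic progressions and a finite set. -/
theorem Int.exists_eq_union_progressions (Z : Set ℤ) (J : ℕ) (hJ : 1 ≤ J)
    (h : ∀ a : ℤ, {k : ℤ | a + J * k ∈ Z}.Infinite → ∀ k : ℤ, a + J * k ∈ Z) :
    ∃ (Fs : Set ℤ) (P : Finset (ℤ × ℕ)), Fs.Finite ∧ (∀ pr ∈ P, 1 ≤ pr.2) ∧
      Z = Fs ∪ ⋃ pr ∈ P, {x : ℤ | ∃ d : ℤ, x = pr.1 + pr.2 * d} := by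
  classical
  set I := (Finset.range J).filter fun a : ℕ => {k : ℤ | (a : ℤ) + J * k ∈ Z}.Infinite with hI
  refine ⟨⋃ a ∈ (Finset.range J).filter (fun a : ℕ => ¬ {k : ℤ | (a : ℤ) + J * k ∈ Z}.Infinite),
    (fun k : ℤ => (a : ℤ) + J * k) '' {k : ℤ | (a : ℤ) + J * k ∈ Z},
    I.image fun a : ℕ => ((a : ℤ), J), ?_, ?_, ?_⟩
  · refine Set.Finite.biUnion (Finset.finite_toSet _) fun a ha => ?_
    exact (Set.not_infinite.1 (Finset.mem_filter.1 ha).2).image _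
  · intro pr hpr
    obtain ⟨a, _, rfl⟩ := Finset.mem_image.1 hpr
    exact hJ
  · ext m
    have hJ0 : (0 : ℤ) < J := by omega
    have hm : ((m % J).toNat : ℤ) + J * (m / J) = m := by
      rw [Int.toNat_of_nonneg (Int.emod_nonneg _ hJ0.ne'), Int.emod_add_mul_ediv]
    have hlt : (m % J).toNat < J := by
      have := Int.emod_lt_of_pos m hJ0
      omega
    simp only [Set.mem_union, Set.mem_iUnion, exists_prop, Set.mem_image, Finset.mem_image,
      Finset.mem_filter, Finset.mem_range, Set.mem_ofPred_eq, hI]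
    constructor
    · intro hmZ
      by_cases hc : {k : ℤ | ((m % J).toNat : ℤ) + J * k ∈ Z}.Infinite
      · exact Or.inr ⟨_, ⟨_, ⟨hlt, hc⟩, rfl⟩, m / J, hm.symm⟩
      · exact Or.inl ⟨_, ⟨hlt, hc⟩, m / J, by rwa [hm], hm⟩
    · rintro (⟨a, _, k, hk, rfl⟩ | ⟨_, ⟨a, ⟨_, ha⟩, rfl⟩, d, rfl⟩)
      · exact hk
      · exact h a ha d

namespace MvPolynomial

/-- The conclusion for an orbit over a ring that is finite over the `p`-adic integers, phrased in
terms of the properties of the uniformiser `π = p` that are needed. -/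
theorem eval_orbit_eq_zero_of_infinite {B : Type*} [CommRing B] {ι : Type*} [IsDomain B]
    [CharZero B] [Fintype ι] (π : B) [Finite (B ⧸ Ideal.span {π ^ 2})]
    (hfac : ∀ i : ℕ, ∃ c : B, π ^ i = i.factorial * (π ^ ((i + 1) / 2) * c))
    (hsep : ∀ x : B, (∀ k : ℕ, π ^ k ∣ x) → x = 0) (F G : ι → MvPolynomial ι B)
    (hGF : ∀ i, bind₁ F (G i) = X i) (hFG : ∀ i, bind₁ G (F i) = X i) (z : ℤ → ι → B)
    (hF : ∀ m, evalMap F (z m) = z (m + 1)) (hG : ∀ m, evalMap G (z m) = z (m - 1)) :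
    ∃ J : ℕ, 1 ≤ J ∧ ∀ (f : MvPolynomial ι B) (a : ℤ),
      {k : ℤ | eval (z (a + J * k)) f = 0}.Infinite → ∀ k : ℤ, eval (z (a + J * k)) f = 0 := by
  refine ⟨Nat.card (Equiv.Perm (ι → B ⧸ Ideal.span {π ^ 2})), Nat.card_pos, fun f a hinf k => ?_⟩
  have h₁ := sq_dvd_iterate_evalMap_sub π F G hGF
  have h₂ := sq_dvd_iterate_evalMap_sub π G F hFG
  set J := Nat.card (Equiv.Perm (ι → B ⧸ Ideal.span {π ^ 2}))
  have hFk : ∀ (k : ℕ) m, (evalMap F)^[k] (z m) = z (m + k) := by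
    intro k
    induction k with
    | zero => simp
    | succ k ih => intro m; rw [Function.iterate_succ_apply', ih, hF]; push_cast; ring_nf
  have hGk : ∀ (k : ℕ) m, (evalMap G)^[k] (z m) = z (m - k) := by
    intro k
    induction k with
    | zero => simp
    | succ k ih => intro m; rw [Function.iterate_succ_apply', ih, hG]; push_cast; ring_nf
  refine Int.mem_of_infinite hinf (fun b hb k => ?_) (fun b hb k => ?_) k
  · have := eval_iterate_eq_zero_of_infinite π hfac hsep F J h₁ (z (a + J * b)) f
    simp only [hFk, Nat.cast_mul, add_assoc, ← mul_add] at this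
    exact this hb k
  · have := eval_iterate_eq_zero_of_infinite π hfac hsep G J h₂ (z (a + J * b)) f
    simp only [hGk, Nat.cast_mul, add_sub_assoc, ← mul_sub] at this
    exact this hb k

end MvPolynomial

namespace PadicInt

theorem exists_pow_eq_factorial_mul (p : ℕ) [hp : Fact p.Prime] (hp3 : 3 ≤ p) (i : ℕ) :
    ∃ c : ℤ_[p], (p : ℤ_[p]) ^ i = i.factorial * ((p : ℤ_[p]) ^ ((i + 1) / 2) * c) := by
  have h0 : (i.factorial : ℤ_[p]) ≠ 0 := Nat.cast_ne_zero.2 i.factorial_ne_zero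
  have hv : (i.factorial : ℤ_[p]).valuation = padicValNat p i.factorial := by
    have := valuation_coe (i.factorial : ℤ_[p])
    rw [coe_natCast, Padic.valuation_natCast] at this
    exact_mod_cast this.symm
  set v := padicValNat p i.factorial with hv'
  have hle : v + (i + 1) / 2 ≤ i := by
    rcases Nat.eq_zero_or_pos i with rfl | hi
    · simp [hv']
    · have h : (p - 1) * v < i := sub_one_mul_padicValNat_factorial_lt_of_ne_zero p hi.ne'
      have h' : 2 * v ≤ (p - 1) * v := Nat.mul_le_mul_right _ (by omega)
      omega
  refine ⟨↑(unitCoeff h0)⁻¹ * (p : ℤ_[p]) ^ (i - v - (i + 1) / 2), ?_⟩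
  have hspec := unitCoeff_spec h0
  rw [hv] at hspec
  have hu : (unitCoeff h0 : ℤ_[p]) * ↑(unitCoeff h0)⁻¹ = 1 := Units.mul_inv _
  have hpow : (p : ℤ_[p]) ^ i
      = (p : ℤ_[p]) ^ v * ((p : ℤ_[p]) ^ ((i + 1) / 2) * (p : ℤ_[p]) ^ (i - v - (i + 1) / 2)) := by
    rw [← pow_add, ← pow_add]
    congr 1
    omega
  rw [hpow]
  linear_combination -((p : ℤ_[p]) ^ ((i + 1) / 2) * ↑(unitCoeff h0)⁻¹
    * (p : ℤ_[p]) ^ (i - v - (i + 1) / 2)) * hspec - ((p : ℤ_[p]) ^ v * ((p : ℤ_[p]) ^ ((i + 1) / 2)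
    * (p : ℤ_[p]) ^ (i - v - (i + 1) / 2))) * hu

instance hasFiniteQuotients (p : ℕ) [Fact p.Prime] : Ring.HasFiniteQuotients ℤ_[p] where
  finiteQuotient {I} hI := by
    obtain ⟨n, rfl⟩ := ideal_eq_span_pow_p hI
    rw [← ker_toZModPow n]
    have : NeZero (p ^ n) := ⟨pow_ne_zero _ (Fact.out : p.Prime).ne_zero⟩
    exact Finite.of_injective _ (toZModPow (p := p) n).kerLift_injective

instance uncountable (p : ℕ) [Fact p.Prime] : Uncountable ℤ_[p] := by
  by_contra h
  rw [not_uncountable_iff] at h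
  have : Countable ℚ_[p] := by
    refine Function.Surjective.countable (f := fun x : ℤ_[p] × ℤ_[p] =>
      algebraMap ℤ_[p] ℚ_[p] x.1 / algebraMap ℤ_[p] ℚ_[p] x.2) fun y => ?_
    obtain ⟨a, b, _, rfl⟩ := IsFractionRing.div_surjective (A := ℤ_[p]) y
    exact ⟨(a, b), rfl⟩
  have hcont := continuum_le_cardinal_of_nontriviallyNormedField ℚ_[p]
  exact absurd (hcont.trans (Cardinal.mk_le_aleph0)) (not_le.2 Cardinal.aleph0_lt_continuum)

/-- There are arbitrarily many algebraically independent elements in the maximal ideal. -/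
theorem exists_algebraicIndependent_dvd (p : ℕ) [hp : Fact p.Prime] (ι : Type*) [Finite ι] :
    ∃ ω : ι → ℤ_[p], AlgebraicIndependent ℤ ω ∧ ∀ i, (p : ℤ_[p]) ∣ ω i := by
  have hp0 : (p : ℤ_[p]) ≠ 0 := Nat.cast_ne_zero.2 hp.out.ne_zero
  set s : Set ℤ_[p] := {x | (p : ℤ_[p]) ∣ x}
  have : Algebra.IsAlgebraic (Algebra.adjoin ℤ s) ℤ_[p] := by
    refine ⟨fun x => ?_⟩
    have hx : IsAlgebraic (Algebra.adjoin ℤ s) ((p : ℤ_[p]) * x) :=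
      isAlgebraic_algebraMap
        (⟨_, Algebra.subset_adjoin (dvd_mul_right _ _)⟩ : Algebra.adjoin ℤ s)
    exact .of_mul (mem_nonZeroDivisors_of_ne_zero hp0) (isAlgebraic_natCast p) hx
  obtain ⟨t, hts, ht⟩ := exists_isTranscendenceBasis_subset (R := ℤ) s
  have hinf : Infinite t := by
    by_contra hfin
    rw [not_infinite_iff_finite] at hfin
    have hc : Countable (Algebra.adjoin ℤ (Set.range ((↑) : t → ℤ_[p]))) := by
      have : Countable (MvPolynomial t ℤ) := by
        rw [← Cardinal.mk_le_aleph0_iff]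
        exact MvPolynomial.cardinalMk_le_max.trans (by simp)
      exact ht.1.aevalEquiv.symm.toEquiv.countable_iff.2 this
    have halg := ht.isAlgebraic
    have h := Algebra.IsAlgebraic.cardinalMk_le_max
      (Algebra.adjoin ℤ (Set.range ((↑) : t → ℤ_[p]))) ℤ_[p]
    rw [max_eq_right (Cardinal.mk_le_aleph0), Cardinal.mk_le_aleph0_iff] at h
    exact not_countable h
  let e : ι ↪ t := (Finite.equivFin ι).toEmbedding.trans
    (Fin.valEmbedding.trans (Infinite.natEmbedding t))
  exact ⟨fun i => e i, ht.1.comp e e.injective, fun i => hts (e i).2⟩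

end PadicInt

theorem AlgebraicIndependent.add_intCast {A ι : Type*} [CommRing A] {ω : ι → A}
    (h : AlgebraicIndependent ℤ ω) (z : ι → ℤ) :
    AlgebraicIndependent ℤ fun i => ω i + (z i : A) := by
  have h₁ : (MvPolynomial.aeval fun i => ω i + (z i : A)) = (MvPolynomial.aeval ω).comp
      (MvPolynomial.aeval (R := ℤ) fun i => MvPolynomial.X i + MvPolynomial.C (z i)) := by
    apply MvPolynomial.algHom_ext
    simp
  have h₂ : Function.LeftInverse
      (MvPolynomial.aeval (R := ℤ) fun i => MvPolynomial.X i - MvPolynomial.C (z i))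
      (MvPolynomial.aeval (R := ℤ) fun i => MvPolynomial.X i + MvPolynomial.C (z i)) := by
    intro q
    rw [← AlgHom.comp_apply]
    convert AlgHom.id_apply (R := ℤ) q
    apply MvPolynomial.algHom_ext
    simp
  rw [algebraicIndependent_iff_injective_aeval, h₁, AlgHom.coe_comp]
  exact (algebraicIndependent_iff_injective_aeval.1 h).comp h₂.injective

/-- A nonzero integral polynomial takes a unit value at some algebraically independent tuple of
`p`-adic integers, for some prime `p ≥ 3`. -/
theorem PadicInt.exists_algebraicIndependent_isUnit {ι : Type*} [Finite ι] (c : MvPolynomial ι ℤ)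
    (hc : c ≠ 0) : ∃ (p : ℕ) (_ : Fact p.Prime) (τ : ι → ℤ_[p]), 3 ≤ p ∧
      AlgebraicIndependent ℤ τ ∧ IsUnit (MvPolynomial.aeval τ c) := by
  obtain ⟨z, hz⟩ : ∃ z, MvPolynomial.eval z c ≠ 0 := by
    by_contra! h
    exact hc (MvPolynomial.funext fun x => by simpa using h x)
  obtain ⟨p, hpge, hp⟩ := Nat.exists_infinite_primes ((MvPolynomial.eval z c).natAbs + 3)
  have : Fact p.Prime := ⟨hp⟩
  obtain ⟨ω, hω, hdvd⟩ := PadicInt.exists_algebraicIndependent_dvd p ι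
  refine ⟨p, ⟨hp⟩, fun i => ω i + (z i : ℤ_[p]), by omega, hω.add_intCast z, ?_⟩
  by_contra hu
  have hmem : MvPolynomial.aeval (fun i => ω i + (z i : ℤ_[p])) c
      ∈ RingHom.ker (PadicInt.toZMod (p := p)) := by
    rw [PadicInt.ker_toZMod]
    exact hu
  have hω0 : ∀ i, PadicInt.toZMod (ω i) = 0 := fun i => by
    obtain ⟨a, ha⟩ := hdvd i
    rw [ha, map_mul, map_natCast, ZMod.natCast_self, zero_mul]
  have hval : PadicInt.toZMod (MvPolynomial.aeval (fun i => ω i + (z i : ℤ_[p])) c)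
      = ((MvPolynomial.eval z c : ℤ) : ZMod p) := by
    have h : (PadicInt.toZMod (p := p)).comp
        (MvPolynomial.aeval (R := ℤ) fun i => ω i + (z i : ℤ_[p])).toRingHom
        = (Int.castRingHom (ZMod p)).comp (MvPolynomial.eval z) := by
      apply MvPolynomial.ringHom_ext <;> simp [hω0]
    exact DFunLike.congr_fun h c
  rw [RingHom.mem_ker, hval, ZMod.intCast_zmod_eq_zero_iff_dvd] at hmem
  have := Int.natAbs_le_of_dvd_ne_zero hmem hz
  simp only [Int.natAbs_natCast] at this
  omega

/-- A version of the Lech embedding theorem: a finitely generated domain of characteristic zero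
embeds into a finite extension of the `p`-adic integers, for some prime `p ≥ 3`. -/
theorem exists_injective_padicInt_finite (R : Type*) [CommRing R] [IsDomain R] [CharZero R]
    [hR : Algebra.FiniteType ℤ R] :
    ∃ (p : ℕ) (_ : Fact p.Prime) (B : Subalgebra ℤ_[p] (AlgebraicClosure ℚ_[p])) (φ : R →+* B),
      3 ≤ p ∧ Module.Finite ℤ_[p] B ∧ Function.Injective φ := by
  classical
  obtain ⟨s, hs⟩ := hR.out
  have : Algebra.IsAlgebraic (Algebra.adjoin ℤ (s : Set R)) R := by
    refine ⟨fun x => ?_⟩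
    have hx : x ∈ Algebra.adjoin ℤ (s : Set R) := hs ▸ Algebra.mem_top
    exact isAlgebraic_algebraMap (⟨x, hx⟩ : Algebra.adjoin ℤ (s : Set R))
  obtain ⟨t, hts, ht⟩ := exists_isTranscendenceBasis_subset (R := ℤ) (s : Set R)
  have htfin : Finite t := (s.finite_toSet.subset hts).to_subtype
  have halg := ht.isAlgebraic
  set A := Algebra.adjoin ℤ (Set.range ((↑) : t → R)) with hA
  obtain ⟨c, hc0, hc⟩ := Algebra.IsAlgebraic.exists_integral_multiples A s
  obtain ⟨p, hp, τ, hp3, hτ, hunit⟩ := PadicInt.exists_algebraicIndependent_isUnit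
    (ht.1.aevalEquiv.symm c) (by simpa using hc0)
  set Ω := AlgebraicClosure ℚ_[p]
  let f : A →+* ℤ_[p] := (MvPolynomial.aeval τ).toRingHom.comp
    (ht.1.aevalEquiv.symm : A →+* MvPolynomial t ℤ)
  have hf : Function.Injective f := by
    change Function.Injective (MvPolynomial.aeval τ ∘ ht.1.aevalEquiv.symm)
    exact (algebraicIndependent_iff_injective_aeval.1 hτ).comp ht.1.aevalEquiv.symm.injective
  have hinj : Function.Injective (algebraMap ℤ_[p] Ω) := by
    rw [IsScalarTower.algebraMap_eq ℤ_[p] ℚ_[p] Ω]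
    exact (algebraMap ℚ_[p] Ω).injective.comp (IsFractionRing.injective ℤ_[p] ℚ_[p])
  let _ : Algebra A Ω := ((algebraMap ℤ_[p] Ω).comp f).toAlgebra
  have hAΩ : Function.Injective (algebraMap A Ω) := hinj.comp hf
  have : Module.IsTorsionFree A Ω := Module.isTorsionFree_iff_algebraMap_injective.2 hAΩ
  let ψ : R →ₐ[A] Ω := IsAlgClosed.lift
  have hψ : Function.Injective ψ := by
    rw [injective_iff_map_eq_zero]
    intro x hx
    by_contra hx0
    obtain ⟨a, ha0, b, hb⟩ := (Algebra.IsAlgebraic.isAlgebraic (R := A) x).exists_nonzero_dvd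
      (mem_nonZeroDivisors_of_ne_zero hx0)
    refine ha0 (hAΩ ?_)
    rw [map_zero, ← ψ.commutes, hb, map_mul, hx, zero_mul]
  have hint : ∀ x ∈ s, IsIntegral ℤ_[p] (ψ x) := by
    intro x hx
    have h₁ : IsIntegral ℤ_[p] (ψ (c • x)) :=
      IsIntegral.map_of_comp_eq f ψ.toRingHom (by ext a; exact (ψ.commutes a).symm) (hc x hx)
    obtain ⟨u, hu⟩ := hunit
    have h₂ : ψ x = algebraMap ℤ_[p] Ω ↑u⁻¹ * ψ (c • x) := by
      rw [map_smul, Algebra.smul_def]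
      change ψ x = algebraMap ℤ_[p] Ω ↑u⁻¹ * (algebraMap ℤ_[p] Ω (f c) * ψ x)
      have hfc : f c = u := hu.symm
      rw [hfc, ← mul_assoc, ← map_mul, Units.inv_mul, map_one, one_mul]
    rw [h₂]
    exact isIntegral_algebraMap.mul h₁
  have hrange : ∀ x, ψ x ∈ Algebra.adjoin ℤ_[p] (ψ '' s) := by
    intro x
    have hx : x ∈ Algebra.adjoin ℤ (s : Set R) := hs ▸ Algebra.mem_top
    induction hx using Algebra.adjoin_induction with
    | mem x hx => exact Algebra.subset_adjoin ⟨x, hx, rfl⟩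
    | algebraMap r => simp
    | add x y _ _ hx hy => rw [map_add]; exact add_mem hx hy
    | mul x y _ _ hx hy => rw [map_mul]; exact mul_mem hx hy
  refine ⟨p, hp, Algebra.adjoin ℤ_[p] (ψ '' s), ψ.toRingHom.codRestrict _ hrange, hp3, ?_, ?_⟩
  · refine Module.Finite.iff_fg.2 (fg_adjoin_of_finite (s.finite_toSet.image _) ?_)
    rintro _ ⟨x, hx, rfl⟩
    exact hint x hx
  · exact fun x y hxy => hψ (congrArg Subtype.val hxy)

namespace PadicInt

variable {p : ℕ} [hp : Fact p.Prime] {B : Type*} [CommRing B] [IsDomain B] [CharZero B]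
  [Algebra ℤ_[p] B]

theorem algebraMap_injective_of_charZero : Function.Injective (algebraMap ℤ_[p] B) := by
  rw [RingHom.injective_iff_ker_eq_bot]
  by_contra h
  obtain ⟨n, hn⟩ := ideal_eq_span_pow_p h
  have hmem : (p : ℤ_[p]) ^ n ∈ RingHom.ker (algebraMap ℤ_[p] B) :=
    hn ▸ Ideal.mem_span_singleton_self _
  rw [RingHom.mem_ker, map_pow, map_natCast] at hmem
  exact pow_ne_zero n (Nat.cast_ne_zero.2 hp.out.ne_zero) hmem

variable [Module.Finite ℤ_[p] B]

variable (p) in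
theorem eq_zero_of_forall_pow_dvd {x : B} (hx : ∀ k : ℕ, (p : B) ^ k ∣ x) : x = 0 := by
  have : FaithfulSMul ℤ_[p] B :=
    (faithfulSMul_iff_algebraMap_injective _ _).2 algebraMap_injective_of_charZero
  have : IsNoetherianRing B := IsNoetherianRing.of_finite ℤ_[p] B
  have htop : Ideal.span {(p : B)} ≠ ⊤ := by
    rw [Ne, Ideal.span_singleton_eq_top, ← map_natCast (algebraMap ℤ_[p] B)]
    exact fun hu => prime_p.not_isUnit (isUnit_of_map_unit (algebraMap ℤ_[p] B) _ hu)
  rw [← Ideal.mem_bot, ← Ideal.iInf_pow_eq_bot_of_isDomain _ htop, Ideal.mem_iInf]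
  intro k
  rw [Ideal.span_singleton_pow, Ideal.mem_span_singleton]
  exact hx k

end PadicInt

namespace MvPolynomial

theorem eval_comp_map {A C ι : Type*} [CommRing A] [CommRing C] (φ : A →+* C) (x : ι → A)
    (f : MvPolynomial ι A) : eval (φ ∘ x) (map φ f) = φ (eval x f) := by
  rw [eval_map, eval₂_comp]

/-- Along an orbit of a polynomial automorphism over a finitely generated domain of characteristic
zero, there is a period `J` such that every polynomial vanishing infinitely often along a residue
class mod `J` vanishes along the whole class. -/
theorem eval_orbit_eq_zero_of_infinite_of_finiteType {R ι : Type*} [CommRing R] [IsDomain R]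
    [CharZero R] [Algebra.FiniteType ℤ R] [Fintype ι] (F G : ι → MvPolynomial ι R)
    (hGF : ∀ i, bind₁ F (G i) = X i) (hFG : ∀ i, bind₁ G (F i) = X i) (z : ℤ → ι → R)
    (hF : ∀ m, evalMap F (z m) = z (m + 1)) (hG : ∀ m, evalMap G (z m) = z (m - 1)) :
    ∃ J : ℕ, 1 ≤ J ∧ ∀ (f : MvPolynomial ι R) (a : ℤ),
      {k : ℤ | eval (z (a + J * k)) f = 0}.Infinite → ∀ k : ℤ, eval (z (a + J * k)) f = 0 := by
  obtain ⟨p, hp, B, φ, hp3, hfin, hφ⟩ := exists_injective_padicInt_finite R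
  have : CharZero B := charZero_of_injective_ringHom hφ
  have : Ring.HasFiniteQuotients B := .of_module_finite ℤ_[p] B
  have : Finite (B ⧸ Ideal.span {(p : B) ^ 2}) := by
    refine Ring.HasFiniteQuotients.finiteQuotient ?_
    rw [Ne, Ideal.span_singleton_eq_bot]
    exact pow_ne_zero 2 (Nat.cast_ne_zero.2 hp.out.ne_zero)
  obtain ⟨J, hJ, h⟩ := eval_orbit_eq_zero_of_infinite (p : B) (fun i => by
      obtain ⟨c, hc⟩ := PadicInt.exists_pow_eq_factorial_mul p hp3 i
      exact ⟨algebraMap ℤ_[p] B c, by simpa using congrArg (algebraMap ℤ_[p] B) hc⟩)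
    (fun x => PadicInt.eq_zero_of_forall_pow_dvd p)
    (fun i => map φ (F i)) (fun i => map φ (G i))
    (fun i => by rw [← map_bind₁, hGF, map_X]) (fun i => by rw [← map_bind₁, hFG, map_X])
    (fun m => φ ∘ z m) (fun m => by rw [map_evalMap, hF]) (fun m => by rw [map_evalMap, hG])
  refine ⟨J, hJ, fun f a => ?_⟩
  simpa only [eval_comp_map, map_eq_zero_iff φ hφ] using h (map φ f) a

/-- A version of `MvPolynomial.eval_orbit_eq_zero_of_infinite_of_finiteType` without finiteness
assumptions on the ring, for finitely many polynomials at a time. -/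
theorem exists_eval_orbit_eq_zero_of_infinite {K ι : Type*} [CommRing K] [IsDomain K]
    [CharZero K] [Fintype ι] (F G : ι → MvPolynomial ι K)
    (hGF : ∀ i, bind₁ F (G i) = X i) (hFG : ∀ i, bind₁ G (F i) = X i) (z : ℤ → ι → K)
    (hF : ∀ m, evalMap F (z m) = z (m + 1)) (hG : ∀ m, evalMap G (z m) = z (m - 1))
    (Q : Finset (MvPolynomial ι K)) :
    ∃ J : ℕ, 1 ≤ J ∧ ∀ f ∈ Q, ∀ a : ℤ,
      {k : ℤ | eval (z (a + J * k)) f = 0}.Infinite → ∀ k : ℤ, eval (z (a + J * k)) f = 0 := by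
  set s : Set K := (⋃ i, ((F i).coeffs : Set K)) ∪ (⋃ i, ((G i).coeffs : Set K)) ∪
    (⋃ f ∈ Q, (f.coeffs : Set K)) ∪ Set.range (z 0) with hs
  have hsfin : s.Finite := by
    refine .union (.union (.union ?_ ?_) ?_) (Set.finite_range _)
    · exact Set.finite_iUnion fun i => Finset.finite_toSet _
    · exact Set.finite_iUnion fun i => Finset.finite_toSet _
    · exact Q.finite_toSet.biUnion fun f _ => Finset.finite_toSet _
  let R := Algebra.adjoin ℤ s
  have : Algebra.FiniteType ℤ R := Algebra.FiniteType.adjoin_of_finite hsfin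
  let j : R →+* K := algebraMap R K
  have hj : Function.Injective j := Subtype.val_injective
  have hlift : ∀ f : MvPolynomial ι K, (f.coeffs : Set K) ⊆ s → ∃ g, map j g = f := fun f hf =>
    mem_range_map_iff_coeffs_subset.2 fun c hc => ⟨⟨c, Algebra.subset_adjoin (hf hc)⟩, rfl⟩
  have hsF : ∀ i, ((F i).coeffs : Set K) ⊆ s := fun i c hc =>
    .inl (.inl (.inl (Set.mem_iUnion.2 ⟨i, hc⟩)))
  have hsG : ∀ i, ((G i).coeffs : Set K) ⊆ s := fun i c hc =>
    .inl (.inl (.inr (Set.mem_iUnion.2 ⟨i, hc⟩)))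
  choose F' hF' using fun i => hlift (F i) (hsF i)
  choose G' hG' using fun i => hlift (G i) (hsG i)
  have hFF' : (fun i => map j (F' i)) = F := _root_.funext hF'
  have hGG' : (fun i => map j (G' i)) = G := _root_.funext hG'
  have hmap := map_injective (σ := ι) j hj
  have hy : ∀ m : ℤ, ∃ y : ι → R, j ∘ y = z m := by
    intro m
    induction m using Int.induction_on with
    | zero => exact ⟨fun i => ⟨z 0 i, Algebra.subset_adjoin (.inr ⟨i, rfl⟩)⟩, rfl⟩
    | succ m ih =>
      obtain ⟨y, hy⟩ := ih
      exact ⟨evalMap F' y, by rw [← map_evalMap, hFF', hy, hF]⟩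
    | pred m ih =>
      obtain ⟨y, hy⟩ := ih
      exact ⟨evalMap G' y, by rw [← map_evalMap, hGG', hy, hG]⟩
  choose y hy using hy
  obtain ⟨J, hJ, h⟩ := eval_orbit_eq_zero_of_infinite_of_finiteType F' G'
    (fun i => hmap (by rw [map_bind₁, hFF', hG', hGF, map_X]))
    (fun i => hmap (by rw [map_bind₁, hGG', hF', hFG, map_X])) y
    (fun m => hj.comp_left (by dsimp only; rw [← map_evalMap, hFF', hy, hy, hF]))
    (fun m => hj.comp_left (by dsimp only; rw [← map_evalMap, hGG', hy, hy, hG]))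
  refine ⟨J, hJ, fun f hf a => ?_⟩
  obtain ⟨g, rfl⟩ := hlift f fun c hc => .inl (.inr (Set.mem_biUnion hf hc))
  simpa only [← hy, eval_comp_map, map_eq_zero_iff j hj] using h g a

end MvPolynomial

/-- The generalised Skolem–Mahler–Lech theorem for affine space: if `σ` is a polynomial
automorphism of `𝔸^n_K` (`char K = 0`), `q ∈ K^n`, and `X` is the zero set of finitely
many polynomials, then `{m ∈ ℤ : σ^m(q) ∈ X}` is a union of finitely many complete
doubly-infinite arithmetic progressions and a finite set. -/
theorem stmt19 (K : Type*) [Field K] [CharZero K] (n : ℕ)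
    (e : Equiv.Perm (Fin n → K))
    (F G : Fin n → MvPolynomial (Fin n) K)
    (hF : ∀ x i, e x i = MvPolynomial.eval x (F i))
    (hG : ∀ x i, e.symm x i = MvPolynomial.eval x (G i))
    (q : Fin n → K) (Q : Finset (MvPolynomial (Fin n) K))
    (X : Set (Fin n → K)) (hX : X = {x | ∀ f ∈ Q, MvPolynomial.eval x f = 0}) :
    ∃ (Fs : Set ℤ) (P : Finset (ℤ × ℕ)), Fs.Finite ∧ (∀ pr ∈ P, 1 ≤ pr.2) ∧
      {m : ℤ | (e ^ m) q ∈ X} =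
        Fs ∪ ⋃ pr ∈ P, {x : ℤ | ∃ d : ℤ, x = pr.1 + pr.2 * d} := by
  have hGF : ∀ i, MvPolynomial.bind₁ F (G i) = MvPolynomial.X i := fun i =>
    MvPolynomial.funext fun x => by
      have h := MvPolynomial.eval_iterate_bind₁ F x 1 (G i)
      rw [Function.iterate_one, Function.iterate_one] at h
      rw [h, ← hG, MvPolynomial.eval_X, show MvPolynomial.evalMap F x = e x from
        (funext (hF x)).symm, e.symm_apply_apply]
  have hFG : ∀ i, MvPolynomial.bind₁ G (F i) = MvPolynomial.X i := fun i =>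
    MvPolynomial.funext fun x => by
      have h := MvPolynomial.eval_iterate_bind₁ G x 1 (F i)
      rw [Function.iterate_one, Function.iterate_one] at h
      rw [h, ← hF, MvPolynomial.eval_X, show MvPolynomial.evalMap G x = e.symm x from
        (funext (hG x)).symm, e.apply_symm_apply]
  obtain ⟨J, hJ, h⟩ := MvPolynomial.exists_eval_orbit_eq_zero_of_infinite F G hGF hFG
    (fun m => (e ^ m) q)
    (fun m => by
      rw [add_comm, zpow_one_add, Equiv.Perm.mul_apply]
      exact (funext (hF _)).symm)
    (fun m => by
      rw [sub_eq_neg_add, zpow_add, zpow_neg_one, Equiv.Perm.mul_apply]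
      exact (funext (hG _)).symm) Q
  subst hX
  refine Int.exists_eq_union_progressions _ J hJ fun a ha k f hf => ?_
  exact h f hf a (ha.mono fun k
    (hk : ∀ f ∈ Q, MvPolynomial.eval ((e ^ (a + J * k)) q) f = 0) => hk f hf) k
end
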